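/- For each p ∈ (1,∞) there exists a constant C_p > 0, independent of the dimension d ∈ ℤ_+, such that for every d ∈ ℤ_+, every J ∈ ℤ_+, every strictly increasing sequence I = (I_0 < I_1 < … < I_J) in (0,∞), and every f ∈ ℓ^p(ℤ^d), one has ‖ O_{I,J}^2(G_t f : t>0) ‖_{ℓ^p(ℤ^d)} ≤ C_p ‖f‖_{ℓ^p(ℤ^d)}. -/

import Mathlib

open scoped ENNReal Real BigOperators
open Real

/-- The one-dimensional Theta function `θ_t(ζ) = Σ_{k∈ℤ} exp(-π(k-ζ)²t)`. -/
noncomputable def theta (t ζ : ℝ) : ℝ :=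
  ∑' k : ℤ, Real.exp (-π * ((k : ℝ) - ζ) ^ 2 * t)

/-- The d-dimensional Theta function `Θ_t(ξ) = Π_j θ_t(ξ_j)`. -/
noncomputable def bigTheta (d : ℕ) (t : ℝ) (ξ : Fin d → ℝ) : ℝ :=
  ∏ j, theta t (ξ j)

/-- The discrete normalized Gaussian kernel `g_t(n) = Θ_{1/t}(0)⁻¹ exp(-π|n|²/t)`. -/
noncomputable def gauss (d : ℕ) (t : ℝ) (n : Fin d → ℤ) : ℝ :=
  (bigTheta d (1 / t) 0)⁻¹ * Real.exp (-π * (∑ j, ((n j : ℝ)) ^ 2) / t)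

/-- The convolution operator `G_t f(x) = Σ_n g_t(n) f(x-n)` on ℤ^d. -/
noncomputable def gConv (d : ℕ) (t : ℝ) (f : (Fin d → ℤ) → ℂ) (x : Fin d → ℤ) : ℂ :=
  ∑' n : Fin d → ℤ, (gauss d t n : ℂ) * f (x - n)

/-- The ℓ^p norm (valued in ℝ≥0∞) of an ℝ≥0∞-valued function on ℤ^d. -/
noncomputable def lpNorm (d : ℕ) (p : ℝ) (F : (Fin d → ℤ) → ℝ≥0∞) : ℝ≥0∞ :=
  (∑' x : Fin d → ℤ, F x ^ p) ^ (1 / p)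


structure OscSt where
  x : ℝ
  a : ℝ
  O : ℝ
  s : ℝ
  P : ℝ
  G : ℝ

namespace OscSt

def start (x : ℝ) : OscSt := ⟨x, x, 0, x, 0, 0⟩

noncomputable def step (z : OscSt) (y : ℝ) : OscSt :=
  ⟨y, z.a, max z.O |y - z.a|, max z.s y, z.P, z.G⟩

noncomputable def reset (q : ℝ) (z : OscSt) : OscSt :=
  ⟨z.x, z.x, 0, z.s, z.P + z.O ^ 2, z.G + z.P ^ (q - 1) * z.O ^ 2⟩

noncomputable def K (z : OscSt) : ℝ := z.O ^ 2 - 2 * z.O * |z.x - z.a| + 2 * (z.x - z.a) ^ 2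

structure Inv (q : ℝ) (z : OscSt) : Prop where
  hx : 0 ≤ z.x
  hxs : z.x ≤ z.s
  ha : 0 ≤ z.a
  has : z.a ≤ z.s
  hO : |z.x - z.a| ≤ z.O
  hOs : z.O ≤ z.s
  hP : 0 ≤ z.P
  hG : 0 ≤ z.G
  hq : 1 ≤ q → z.P ^ q ≤ q * (z.G + z.s ^ 2 * z.P ^ (q - 1))
  hsP : z.s = 0 → z.P = 0

lemma inv_start {q x : ℝ} (hx : 0 ≤ x) : Inv q (start x) := by
  refine ⟨hx, le_rfl, hx, le_rfl, by simp [start], hx, le_rfl, le_rfl, ?_, fun _ => rfl⟩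
  intro h
  have : (0:ℝ) ^ q = 0 := Real.zero_rpow (by linarith)
  simp only [start, this]
  positivity

lemma inv_step {q : ℝ} {z : OscSt} (h : Inv q z) {y : ℝ} (hy : 0 ≤ y) : Inv q (step z y) := by
  obtain ⟨h1, h2, h3, h4, h5, h6, h7, h8, h9, h10⟩ := h
  refine ⟨hy, le_max_right _ _, h3, le_trans h4 (le_max_left _ _), le_max_right _ _, ?_, h7, h8, ?_, fun h0 => h10 (le_antisymm (h0 ▸ le_max_left _ _) (h1.trans h2))⟩
  · simp only [step]
    refine max_le (le_trans h6 (le_max_left _ _)) ?_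
    rw [abs_le]
    have := le_max_left z.s y
    have := le_max_right z.s y
    constructor <;> linarith
  · intro hq
    refine (h9 hq).trans ?_
    simp only [step]
    have hs : 0 ≤ z.s := h1.trans h2
    have : z.s ^ 2 ≤ (max z.s y) ^ 2 := by
      have := le_max_left z.s y
      gcongr
    gcongr

lemma inv_reset {q : ℝ} {z : OscSt} (h : Inv q z) : Inv q (reset q z) := by
  obtain ⟨h1, h2, h3, h4, h5, h6, h7, h8, h9, h10⟩ := h
  have hO : 0 ≤ z.O := (abs_nonneg _).trans h5
  refine ⟨h1, h2, h1, h2, by simp [reset], h1.trans h2, by simp only [reset]; positivity,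
    by simp only [reset]; positivity, ?_, ?_⟩
  swap
  · intro h0
    have h0' : z.s = 0 := h0
    have hz : z.O = 0 := by linarith
    simp [reset, h10 h0', hz]
  intro hq
  have h9 := h9 hq
  simp only [reset]
  set P := z.P
  set P' := P + z.O ^ 2 with hP'
  have hPP : P ≤ P' := by rw [hP']; nlinarith [sq_nonneg z.O]
  have hP'0 : 0 ≤ P' := h7.trans hPP
  have hm : P ^ (q - 1) ≤ P' ^ (q - 1) := Real.rpow_le_rpow h7 hPP (by linarith)
  have hm0 : 0 ≤ P ^ (q - 1) := Real.rpow_nonneg h7 _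
  have key : P' ^ q ≤ P ^ q + q * z.O ^ 2 * P' ^ (q - 1) := by
    rcases eq_or_lt_of_le hP'0 with h0 | h0
    · rw [← h0, Real.zero_rpow (by linarith)]
      have := Real.rpow_nonneg h7 q
      have := Real.rpow_nonneg (le_refl (0:ℝ)) (q-1)
      positivity
    · -- Bernoulli
      have hb := one_add_mul_self_le_rpow_one_add (s := P / P' - 1) (p := q) (by
        have : 0 ≤ P / P' := by positivity
        linarith) hq
      have e1 : 1 + (P / P' - 1) = P / P' := by ring
      rw [e1, Real.div_rpow h7 hP'0] at hb
      have hpos : 0 < P' ^ q := Real.rpow_pos_of_pos h0 q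
      rw [le_div_iff₀ hpos] at hb
      have e2 : P' ^ q = P' * P' ^ (q - 1) := by
        rw [← Real.rpow_one_add' hP'0 (by linarith)]; congr 1; ring
      have e3 : (1 + q * (P / P' - 1)) * P' ^ q = P' ^ q - q * z.O ^ 2 * P' ^ (q - 1) := by
        rw [e2]; field_simp; rw [hP']; ring
      linarith
  have hs : z.O ^ 2 ≤ z.s ^ 2 := by gcongr
  have : 0 ≤ (z.s ^ 2 - z.O ^ 2) * (P' ^ (q - 1) - P ^ (q - 1)) :=
    mul_nonneg (by linarith) (by linarith)
  have : 0 ≤ q * ((z.s ^ 2 - z.O ^ 2) * (P' ^ (q - 1) - P ^ (q - 1))) := by positivity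
  nlinarith

noncomputable def slope (z : OscSt) : ℝ :=
  -2 * z.O * (if z.a ≤ z.x then 1 else -1) - 4 * z.a

lemma K_step {q : ℝ} {z : OscSt} (h : Inv q z) (y : ℝ) :
    K (step z y) - 2 * y ^ 2 ≤ K z - 2 * z.x ^ 2 + slope z * (y - z.x) := by
  have hO : 0 ≤ z.O := (abs_nonneg _).trans h.hO
  simp only [K, step, slope]
  have h1 : (max z.O |y - z.a|) ^ 2 - 2 * (max z.O |y - z.a|) * |y - z.a| + 2 * (y - z.a) ^ 2
      ≤ z.O ^ 2 - 2 * z.O * |y - z.a| + 2 * (y - z.a) ^ 2 := by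
    rcases le_total z.O |y - z.a| with h | h
    · rw [max_eq_right h]; nlinarith [sq_nonneg (z.O - |y - z.a|)]
    · rw [max_eq_left h]
  split_ifs with hh
  · rw [abs_of_nonneg (sub_nonneg.2 hh)]
    nlinarith [mul_le_mul_of_nonneg_left (le_abs_self (y - z.a)) hO]
  · push Not at hh
    rw [abs_of_neg (sub_neg.2 hh)]
    nlinarith [mul_le_mul_of_nonneg_left (neg_le_abs (y - z.a)) hO]

lemma K_ge (z : OscSt) : z.O ^ 2 / 2 ≤ K z := by
  simp only [K]
  rw [← sq_abs (z.x - z.a)]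
  nlinarith [sq_nonneg (z.O - 2 * |z.x - z.a|)]

/-- Doob potential -/
noncomputable def dU (p : ℝ) (z : OscSt) : ℝ := z.s ^ p - p / (p - 1) * z.s ^ (p - 1) * z.x

lemma dU_step {p q : ℝ} (hp : 1 < p) {z : OscSt} (h : Inv q z) {y : ℝ} :
    dU p (step z y) ≤ dU p z + (-(p / (p - 1) * z.s ^ (p - 1))) * (y - z.x) := by
  have hs : 0 ≤ z.s := h.hx.trans h.hxs
  simp only [dU, step]
  rcases le_total y z.s with hy | hy
  · rw [max_eq_left hy]; apply le_of_eq; ring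
  · rw [max_eq_right hy]
    have hy0 : 0 ≤ y := hs.trans hy
    have e : y ^ (p - 1) * y = y ^ p := by
      conv_lhs => rw [mul_comm, ← Real.rpow_one_add' hy0 (by linarith)]
      congr 1; ring
    have hyoung : p * (z.s ^ (p - 1) * y) ≤ (p - 1) * z.s ^ p + y ^ p := by
      have := Real.geom_mean_le_arith_mean2_weighted (w₁ := (p - 1) / p) (w₂ := 1 / p)
        (p₁ := z.s ^ p) (p₂ := y ^ p) (by have : 0 < p - 1 := by linarith
                                          positivity) (by positivity)
        (Real.rpow_nonneg hs _) (Real.rpow_nonneg hy0 _) (by field_simp; ring)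
      rw [← Real.rpow_mul hs, ← Real.rpow_mul hy0] at this
      have e1 : p * ((p - 1) / p) = p - 1 := by field_simp
      have e2 : p * (1 / p) = 1 := by field_simp
      rw [e1, e2, Real.rpow_one] at this
      calc p * (z.s ^ (p - 1) * y) ≤ p * ((p - 1) / p * z.s ^ p + 1 / p * y ^ p) := by gcongr
        _ = _ := by field_simp
    have hp1 : 0 < p - 1 := by linarith
    have h3 : y ^ p - p / (p - 1) * y ^ (p - 1) * y = - (y ^ p) / (p - 1) := by
      rw [mul_assoc, e]; field_simp; ring
    have h4 : p / (p - 1) * z.s ^ (p - 1) * y ≤ z.s ^ p + y ^ p / (p - 1) := by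
      rw [show p / (p - 1) * z.s ^ (p - 1) * y = (p * (z.s ^ (p - 1) * y)) / (p - 1) by ring,
        div_le_iff₀ hp1]
      calc _ ≤ _ := hyoung
        _ = _ := by field_simp
    rw [h3]
    have h5 : - (y ^ p) / (p - 1) = - (y ^ p / (p - 1)) := by ring
    rw [h5]; nlinarith

lemma dU_start {p x : ℝ} (hp : 1 < p) (hx : 0 ≤ x) : dU p (start x) ≤ 0 := by
  simp only [dU, start]
  have e : x ^ (p - 1) * x = x ^ p := by
    conv_lhs => rw [mul_comm, ← Real.rpow_one_add' hx (by linarith)]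
    congr 1; ring
  rw [mul_assoc, e]
  have hp1 : 0 < p - 1 := by linarith
  have : 1 ≤ p / (p - 1) := by rw [le_div_iff₀ hp1]; linarith
  nlinarith [Real.rpow_nonneg hx p]

lemma young_ex {r A : ℝ} (hr : 0 ≤ r) (hA : 0 < A) : ∃ C : ℝ, 0 ≤ C ∧ ∀ s x : ℝ, 0 ≤ s → 0 ≤ x →
    A * s ^ r * x ≤ 1 / 2 * s ^ (r + 1) + C * x ^ (r + 1) := by
  refine ⟨A * (2 * A) ^ r, by positivity, fun s x hs hx => ?_⟩
  have es : s ^ (r + 1) = s ^ r * s := by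
    rw [Real.rpow_add_one' hs (by linarith)]
  have ex : x ^ (r + 1) = x ^ r * x := by
    rw [Real.rpow_add_one' hx (by linarith)]
  have h0 : 0 ≤ s ^ r := Real.rpow_nonneg hs _
  have h1 : 0 ≤ x ^ r := Real.rpow_nonneg hx _
  rcases le_total (2 * A * x) s with h | h
  · rw [es]
    have : 0 ≤ A * (2 * A) ^ r * x ^ (r + 1) := by positivity
    nlinarith [mul_le_mul_of_nonneg_left h h0]
  · have h2 : s ^ r ≤ (2 * A) ^ r * x ^ r := by
      rw [← Real.mul_rpow (by positivity) hx]
      exact Real.rpow_le_rpow hs h hr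
    have : A * s ^ r * x ≤ A * ((2 * A) ^ r * x ^ r) * x := by gcongr
    rw [ex, es]
    nlinarith [mul_nonneg h0 hs]

lemma dU_final {p : ℝ} (hp : 1 < p) : ∃ C : ℝ, 0 ≤ C ∧ ∀ (q : ℝ) (z : OscSt), Inv q z →
    z.s ^ p ≤ 2 * dU p z + C * z.x ^ p := by
  have hp1 : 0 < p - 1 := by linarith
  obtain ⟨C, hC, H⟩ := young_ex (r := p - 1) (A := p / (p - 1)) (by linarith) (by positivity)
  refine ⟨2 * C, by positivity, fun q z h => ?_⟩
  have := H z.s z.x (h.hx.trans h.hxs) h.hx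
  rw [sub_add_cancel] at this
  simp only [dU]
  linarith

/-- small p potential -/
noncomputable def sU (p : ℝ) (z : OscSt) : ℝ :=
  (z.P / 2 + K z - 2 * z.x ^ 2) * z.s ^ (p - 2) - 8 * z.s ^ p

lemma sU_step {p q : ℝ} (hp : 1 < p) (hp2 : p ≤ 2) {z : OscSt} (h : Inv q z) {y : ℝ}
    (hy0 : 0 ≤ y) (hy2 : y ≤ 2 * z.x) :
    sU p (step z y) ≤ sU p z + z.s ^ (p - 2) * slope z * (y - z.x) := by
  have hs : 0 ≤ z.s := h.hx.trans h.hxs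
  have hK := K_step h y
  have hw : 0 ≤ z.s ^ (p - 2) := Real.rpow_nonneg hs _
  have hPK : 0 ≤ z.P / 2 + K (step z y) := by
    have := K_ge (step z y)
    have := h.hP
    nlinarith [sq_nonneg (step z y).O]
  have e1 : (step z y).P = z.P := rfl
  have e2 : (step z y).x = y := rfl
  have e3 : (step z y).s = max z.s y := rfl
  simp only [sU]
  rw [e1, e2, e3]
  rcases le_total y z.s with hy | hy
  · rw [max_eq_left hy]
    nlinarith [mul_le_mul_of_nonneg_left hK hw]
  · rw [max_eq_right hy]
    rcases eq_or_lt_of_le hs with h0 | h0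
    · have hx0 : z.x = 0 := le_antisymm (h0 ▸ h.hxs) h.hx
      have hyy : y = 0 := by linarith
      have : y = z.s := by linarith
      rw [this]
      rw [this] at hK
      nlinarith [mul_le_mul_of_nonneg_left hK hw]
    · have hyp : 0 < y := h0.trans_le hy
      have hw' : y ^ (p - 2) ≤ z.s ^ (p - 2) :=
        Real.rpow_le_rpow_of_nonpos h0 hy (by linarith)
      -- y^2 s^(p-2) - y^p ≤ 4 (y^p - s^p)
      have ey : y ^ 2 * y ^ (p - 2) = y ^ p := by
        rw [← Real.rpow_natCast, ← Real.rpow_add hyp]; congr 1; norm_num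
      have esp : z.s ^ 2 * z.s ^ (p - 2) = z.s ^ p := by
        rw [← Real.rpow_natCast, ← Real.rpow_add h0]; congr 1; norm_num
      have key : y ^ 2 * z.s ^ (p - 2) - y ^ p ≤ 4 * (y ^ p - z.s ^ p) := by
        set u := y / z.s with hu
        have hyu : y = u * z.s := by rw [hu]; field_simp
        have hu1 : 1 ≤ u := by rw [hu, le_div_iff₀ h0]; linarith
        have hu2 : u ≤ 2 := by rw [hu, div_le_iff₀ h0]; linarith [h.hxs]
        have hu0 : 0 ≤ u := by linarith
        have f1 : y ^ p = u ^ p * z.s ^ p := by rw [hyu, Real.mul_rpow hu0 hs]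
        have f2 : y ^ 2 * z.s ^ (p - 2) = u ^ 2 * z.s ^ p := by rw [hyu, ← esp]; ring
        have f3 : u ≤ u ^ p := by
          conv_lhs => rw [← Real.rpow_one u]
          exact Real.rpow_le_rpow_of_exponent_le hu1 hp.le
        have f4 : u ^ p ≤ u ^ 2 := by
          rw [← Real.rpow_natCast]
          exact Real.rpow_le_rpow_of_exponent_le hu1 (by simpa using hp2)
        have hsp : 0 ≤ z.s ^ p := Real.rpow_nonneg hs _
        rw [f1, f2]
        have : u ^ 2 - u ^ p ≤ 4 * (u ^ p - 1) := by nlinarith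
        nlinarith
      have g1 : (z.P / 2 + K (step z y)) * y ^ (p - 2) ≤ (z.P / 2 + K (step z y)) * z.s ^ (p - 2) :=
        mul_le_mul_of_nonneg_left hw' hPK
      have g2 := mul_le_mul_of_nonneg_left hK hw
      nlinarith

lemma sU_start {p x : ℝ} (hx : 0 ≤ x) : sU p (start x) ≤ 0 := by
  simp only [sU, start, K]
  have := Real.rpow_nonneg hx p
  have := Real.rpow_nonneg hx (p-2)
  simp
  nlinarith [mul_nonneg (sq_nonneg x) this]

lemma sU_reset {p q : ℝ} {z : OscSt} (h : Inv q z) : sU p (reset q z) ≤ sU p z := by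
  have hK := K_ge z
  have hs : 0 ≤ z.s := h.hx.trans h.hxs
  have hw : 0 ≤ z.s ^ (p - 2) := Real.rpow_nonneg hs _
  simp only [sU]
  have : K (reset q z) = 0 := by simp [K, reset]
  rw [this]
  simp only [reset]
  have : (z.P + z.O ^ 2) / 2 + 0 - 2 * z.x ^ 2 ≤ z.P / 2 + K z - 2 * z.x ^ 2 := by linarith
  nlinarith [mul_le_mul_of_nonneg_right this hw]

/-- large p potential, q = p / 2 -/
noncomputable def lU (q : ℝ) (z : OscSt) : ℝ := z.G / 2 + z.P ^ (q - 1) * (K z - 2 * z.x ^ 2)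

lemma lU_step {q : ℝ} {z : OscSt} (h : Inv q z) {y : ℝ} :
    lU q (step z y) ≤ lU q z + z.P ^ (q - 1) * slope z * (y - z.x) := by
  have hK := K_step h y
  have hw : 0 ≤ z.P ^ (q - 1) := Real.rpow_nonneg h.hP _
  have e1 : (step z y).P = z.P := rfl
  have e2 : (step z y).x = y := rfl
  have e3 : (step z y).G = z.G := rfl
  simp only [lU]
  rw [e1, e2, e3]
  nlinarith [mul_le_mul_of_nonneg_left hK hw]

lemma lU_start {q x : ℝ} : lU q (start x) ≤ 0 := by
  simp only [lU, start, K]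
  have := Real.rpow_nonneg (le_refl (0:ℝ)) (q-1)
  simp
  nlinarith [mul_nonneg (sq_nonneg x) this]

lemma lU_reset {q : ℝ} (hq : 1 ≤ q) {z : OscSt} (h : Inv q z) : lU q (reset q z) ≤ lU q z := by
  have hK := K_ge z
  have hw : 0 ≤ z.P ^ (q - 1) := Real.rpow_nonneg h.hP _
  have hm : z.P ^ (q - 1) ≤ (z.P + z.O ^ 2) ^ (q - 1) :=
    Real.rpow_le_rpow h.hP (by nlinarith [sq_nonneg z.O]) (by linarith)
  simp only [lU]
  have : K (reset q z) = 0 := by simp [K, reset]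
  rw [this]
  simp only [reset]
  nlinarith [mul_le_mul_of_nonneg_left hK hw, mul_le_mul_of_nonneg_right hm (sq_nonneg z.x)]

theorem potential (p : ℝ) (hp : 1 < p) : ∃ (C : ℝ) (Ψ h : OscSt → ℝ), 0 ≤ C ∧
    (∀ x, 0 ≤ x → Ψ (start x) ≤ 0) ∧
    (∀ z y, Inv (p / 2) z → 0 ≤ y → y ≤ 2 * z.x → Ψ (step z y) ≤ Ψ z + h z * (y - z.x)) ∧
    (∀ z, Inv (p / 2) z → Ψ (reset (p / 2) z) ≤ Ψ z) ∧
    (∀ z, Inv (p / 2) z → (reset (p / 2) z).P ^ (p / 2) ≤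
      Ψ (reset (p / 2) z) + C * (reset (p / 2) z).x ^ p) := by
  obtain ⟨C, hC, hd⟩ := dU_final hp
  have hdr : ∀ q z, dU p (reset q z) = dU p z := fun q z => rfl
  rcases le_total p 2 with h2 | h2
  · refine ⟨21 * C, fun z => 2 * sU p z + 42 * dU p z,
      fun z => 2 * (z.s ^ (p - 2) * slope z) + 42 * (-(p / (p - 1) * z.s ^ (p - 1))),
      by positivity, ?_, ?_, ?_, ?_⟩
    · intro x hx
      have := dU_start hp hx
      have := sU_start (p := p) hx
      linarith
    · intro z y hz hy hy2
      have := dU_step hp hz (y := y)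
      have := sU_step hp h2 hz hy hy2
      simp only
      linarith
    · intro z hz
      simp only [hdr]
      linarith [sU_reset (p := p) hz]
    · intro z hz
      have hz' := inv_reset hz
      have hK : K (reset (p / 2) z) = 0 := by simp [K, reset]
      set w := reset (p / 2) z
      have h1 := hd _ w hz'
      have hs : 0 ≤ w.s := hz'.hx.trans hz'.hxs
      have hsp : 0 ≤ w.s ^ p := Real.rpow_nonneg hs _
      have hw : 0 ≤ w.s ^ (p - 2) := Real.rpow_nonneg hs _
      have key : w.P ^ (p / 2) ≤ w.P * w.s ^ (p - 2) + w.s ^ p := by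
        rcases le_total w.P (w.s ^ 2) with h | h
        · have : w.P ^ (p / 2) ≤ (w.s ^ 2) ^ (p / 2) :=
            Real.rpow_le_rpow hz'.hP h (by linarith)
          rw [← Real.rpow_natCast, ← Real.rpow_mul hs] at this
          rw [show ((2:ℕ):ℝ) * (p / 2) = p by push_cast; ring] at this
          have := mul_nonneg hz'.hP hw
          linarith
        · rcases eq_or_lt_of_le hs with h0 | h0
          · -- s = 0
            rcases eq_or_lt_of_le h2 with h3 | h3
            · subst h3; simp [← h0]
            · rcases eq_or_lt_of_le hz'.hP with h4 | h4
              · rw [← h4, Real.zero_rpow (by linarith)]; simpa using hsp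
              · exfalso
                have := hz'.hsP h0.symm
                linarith
          · have hP : 0 < w.P := lt_of_lt_of_le (by positivity) h
            have e : w.P ^ (p / 2) = w.P * w.P ^ (p / 2 - 1) := by
              rw [← Real.rpow_one_add' hP.le (by linarith)]; congr 1; ring
            have e2 : w.P ^ (p / 2 - 1) ≤ (w.s ^ 2) ^ (p / 2 - 1) :=
              Real.rpow_le_rpow_of_nonpos (by positivity) h (by linarith)
            rw [← Real.rpow_natCast, ← Real.rpow_mul hs] at e2
            rw [show ((2:ℕ):ℝ) * (p / 2 - 1) = p - 2 by push_cast; ring] at e2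
            rw [e]
            nlinarith [mul_le_mul_of_nonneg_left e2 hz'.hP]
      have hxs : w.x ^ 2 * w.s ^ (p - 2) ≤ w.s ^ p := by
        rcases eq_or_lt_of_le hs with h0 | h0
        · have : w.x = 0 := le_antisymm (h0 ▸ hz'.hxs) hz'.hx
          rw [this]; simpa using hsp
        · have esp : w.s ^ 2 * w.s ^ (p - 2) = w.s ^ p := by
            rw [← Real.rpow_natCast, ← Real.rpow_add h0]; congr 1; norm_num
          have : w.x ^ 2 ≤ w.s ^ 2 := by
            have := hz'.hx; have := hz'.hxs; gcongr
          nlinarith [mul_le_mul_of_nonneg_right this hw]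
      simp only [sU, hK]
      nlinarith
  · have hq : 1 ≤ p / 2 := by linarith
    obtain ⟨C1, hC1, hy⟩ := young_ex (r := p / 2 - 1) (A := 5 * (p / 2)) (by linarith) (by positivity)
    refine ⟨2 * C1 * C, fun z => 4 * (p / 2) * lU (p / 2) z + 4 * C1 * dU p z,
      fun z => 4 * (p / 2) * (z.P ^ (p / 2 - 1) * slope z)
        + 4 * C1 * (-(p / (p - 1) * z.s ^ (p - 1))),
      by positivity, ?_, ?_, ?_, ?_⟩
    · intro x hx
      have a := dU_start hp hx
      have b := lU_start (q := p / 2) (x := x)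
      simp only
      have : 0 < 4 * (p / 2) := by linarith
      nlinarith [mul_nonneg hC1 (neg_nonneg.2 a)]
    · intro z y hz hy hy2
      have a := mul_le_mul_of_nonneg_left (dU_step hp hz (y := y)) hC1
      have b := mul_le_mul_of_nonneg_left (lU_step hz (y := y)) (show 0 ≤ 4 * (p / 2) by linarith)
      simp only
      nlinarith
    · intro z hz
      simp only [hdr]
      have := mul_le_mul_of_nonneg_left (lU_reset hq hz) (show 0 ≤ 4 * (p / 2) by linarith)
      linarith
    · intro z hz
      have hz' := inv_reset hz
      have hK : K (reset (p / 2) z) = 0 := by simp [K, reset]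
      set w := reset (p / 2) z
      have h1 := mul_le_mul_of_nonneg_left (hd _ w hz') hC1
      have hs : 0 ≤ w.s := hz'.hx.trans hz'.hxs
      have h3 := hz'.hq hq
      have h4 := hy w.P (w.s ^ 2) hz'.hP (by positivity)
      rw [sub_add_cancel] at h4
      have e : (w.s ^ 2) ^ (p / 2) = w.s ^ p := by
        rw [← Real.rpow_natCast, ← Real.rpow_mul hs]; congr 1; push_cast; ring
      rw [e] at h4
      have hxs : w.x ^ 2 ≤ w.s ^ 2 := by
        have := hz'.hx; have := hz'.hxs; gcongr
      have hw : 0 ≤ w.P ^ (p / 2 - 1) := Real.rpow_nonneg hz'.hP _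
      have h5 := mul_le_mul_of_nonneg_left hxs (mul_nonneg (show 0 ≤ p / 2 by linarith) hw)
      simp only [lU, hK]
      nlinarith

end OscSt


namespace OscSt

open Classical in
noncomputable def post (q : ℝ) (R : ℕ → Prop) (k : ℕ) (z : OscSt) : OscSt :=
  if R k then reset q z else z

noncomputable def run (q : ℝ) (R : ℕ → Prop) (X : ℕ → ℝ) : ℕ → OscSt
  | 0 => start (X 0)
  | k + 1 => step (post q R k (run q R X k)) (X (k + 1))

lemma post_x (q : ℝ) (R : ℕ → Prop) (k : ℕ) (z : OscSt) : (post q R k z).x = z.x := by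
  unfold post; split_ifs <;> rfl

lemma run_x (q : ℝ) (R : ℕ → Prop) (X : ℕ → ℝ) (k : ℕ) : (run q R X k).x = X k := by
  cases k <;> rfl

lemma run_congr (q : ℝ) (R : ℕ → Prop) {X Y : ℕ → ℝ} (k : ℕ) (h : ∀ i ≤ k, X i = Y i) :
    run q R X k = run q R Y k := by
  induction k with
  | zero => simp [run, h 0 le_rfl]
  | succ k ih => simp only [run]; rw [ih (fun i hi => h i (by omega)), h (k + 1) le_rfl]

lemma inv_post {q : ℝ} {R : ℕ → Prop} {k : ℕ} {z : OscSt} (h : Inv q z) : Inv q (post q R k z) := by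
  unfold post; split_ifs
  · exact inv_reset h
  · exact h

lemma inv_run {q : ℝ} {R : ℕ → Prop} {X : ℕ → ℝ} (hX : ∀ k, 0 ≤ X k) (k : ℕ) :
    Inv q (run q R X k) := by
  induction k with
  | zero => exact inv_start (hX 0)
  | succ k ih => exact inv_step (inv_post ih) (hX _)

lemma post_P_ge (q : ℝ) (R : ℕ → Prop) (k : ℕ) (z : OscSt) : z.P ≤ (post q R k z).P := by
  unfold post; split_ifs
  · simp only [reset]; nlinarith [sq_nonneg z.O]
  · exact le_rfl

lemma post_P_le (q : ℝ) (R : ℕ → Prop) (k : ℕ) (z : OscSt) : (post q R k z).P ≤ (reset q z).P := by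
  unfold post; split_ifs
  · exact le_rfl
  · simp only [reset]; nlinarith [sq_nonneg z.O]

lemma post_P_mono (q : ℝ) (R : ℕ → Prop) (X : ℕ → ℝ) {k l : ℕ} (h : k ≤ l) :
    (post q R k (run q R X k)).P ≤ (post q R l (run q R X l)).P := by
  induction l, h using Nat.le_induction with
  | base => exact le_rfl
  | succ l _ ih => exact ih.trans (post_P_ge q R (l + 1) (run q R X (l + 1)))

lemma block {q : ℝ} {R : ℕ → Prop} {X : ℕ → ℝ} {b b' : ℕ} (hb : b ≤ b') (hR : R b) (hR' : R b')
    (hn : ∀ k, b < k → k < b' → ¬ R k) {i : ℕ} (hi : b ≤ i) (hi' : i ≤ b') :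
    (X i - X b) ^ 2 ≤ (post q R b' (run q R X b')).P - (post q R b (run q R X b)).P := by
  rcases eq_or_lt_of_le hb with rfl | hlt
  · have : i = b := by omega
    subst this; simp
  have claim : ∀ k, b ≤ k → k < b' → (post q R k (run q R X k)).a = X b ∧
      (post q R k (run q R X k)).P = (post q R b (run q R X b)).P ∧
      ∀ i, b ≤ i → i ≤ k → |X i - X b| ≤ (post q R k (run q R X k)).O := by
    intro k hk
    induction k, hk using Nat.le_induction with
    | base =>
      intro _
      refine ⟨?_, rfl, ?_⟩
      · simp [post, hR, reset, run_x]
      · intro i h1 h2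
        have : i = b := by omega
        subst this
        simp [post, hR, reset]
    | succ k hk ih =>
      intro hk'
      obtain ⟨h1, h2, h3⟩ := ih (by omega)
      have e : post q R (k + 1) (run q R X (k + 1)) =
          step (post q R k (run q R X k)) (X (k + 1)) := by
        rw [show run q R X (k + 1) = step (post q R k (run q R X k)) (X (k + 1)) from rfl]
        conv_lhs => unfold post
        rw [if_neg (hn _ (by omega) hk')]
        rfl
      rw [e]
      refine ⟨h1, h2, ?_⟩
      intro i hi1 hi2
      rcases Nat.lt_or_ge k i with h | h
      · have : i = k + 1 := by omega
        subst this
        simp only [step, h1]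
        exact le_max_right _ _
      · exact (h3 i hi1 h).trans (le_max_left _ _)
  obtain ⟨m, rfl⟩ : ∃ m, b' = m + 1 := ⟨b' - 1, by omega⟩
  obtain ⟨h1, h2, h3⟩ := claim m (by omega) (by omega)
  have e : (post q R (m + 1) (run q R X (m + 1))).P =
      (post q R m (run q R X m)).P + (max (post q R m (run q R X m)).O |X (m + 1) - X b|) ^ 2 := by
    rw [show run q R X (m + 1) = step (post q R m (run q R X m)) (X (m + 1)) from rfl]
    conv_lhs => unfold post
    rw [if_pos hR', ← h1]
    rfl
  rw [e, h2, add_sub_cancel_left, ← sq_abs]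
  have : |X i - X b| ≤ max (post q R m (run q R X m)).O |X (m + 1) - X b| := by
    rcases Nat.lt_or_ge m i with h | h
    · have : i = m + 1 := by omega
      subst this
      exact le_max_right _ _
    · exact (h3 i hi h).trans (le_max_left _ _)
  gcongr

lemma osc_bound (q : ℝ) {X : ℕ → ℝ} {b : ℕ → ℕ} (hb : Antitone b) {L J : ℕ}
    (hL : ∀ j, b j ≤ L) {κ : ℕ → ℕ} (h1 : ∀ j < J, b (j + 1) ≤ κ j) (h2 : ∀ j < J, κ j ≤ b j)
    (hX : ∀ k, 0 ≤ X k) :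
    ∑ j ∈ Finset.range J, (X (κ j) - X (b j)) ^ 2 ≤
      4 * (reset q (run q (fun k => ∃ j, b j = k) X L)).P := by
  set R : ℕ → Prop := fun k => ∃ j, b j = k
  have hbl : ∀ j i, b (j + 1) ≤ i → i ≤ b j → (X i - X (b (j + 1))) ^ 2 ≤
      (post q R (b j) (run q R X (b j))).P - (post q R (b (j + 1)) (run q R X (b (j + 1)))).P := by
    intro j i hi hi'
    refine block (hb (show j ≤ j + 1 by omega)) ⟨_, rfl⟩ ⟨_, rfl⟩ ?_ hi hi'
    rintro k hk hk' ⟨j', rfl⟩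
    have a1 : j' < j + 1 := by
      by_contra h; push Not at h
      have := hb h
      omega
    have a2 : j < j' := by
      by_contra h; push Not at h
      have := hb h
      omega
    omega
  calc ∑ j ∈ Finset.range J, (X (κ j) - X (b j)) ^ 2
      ≤ ∑ j ∈ Finset.range J, 4 * ((post q R (b j) (run q R X (b j))).P
          - (post q R (b (j + 1)) (run q R X (b (j + 1)))).P) := by
        refine Finset.sum_le_sum fun j hj => ?_
        have hj := Finset.mem_range.1 hj
        have a := hbl j (κ j) (h1 j hj) (h2 j hj)
        have b' := hbl j (b j) (hb (Nat.le_succ j)) le_rfl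
        nlinarith [sq_nonneg ((X (κ j) - X (b (j + 1))) + (X (b j) - X (b (j + 1))))]
    _ = 4 * ((post q R (b 0) (run q R X (b 0))).P - (post q R (b J) (run q R X (b J))).P) := by
        rw [← Finset.mul_sum, Finset.sum_range_sub' (fun j => (post q R (b j) (run q R X (b j))).P)]
    _ ≤ _ := by
        have a := post_P_mono q R X (hL 0)
        have b' := post_P_le q R L (run q R X L)
        have c := (inv_post (q := q) (R := R) (k := b J) (inv_run (q := q) (R := R) hX (b J))).hP
        linarith

end OscSt

section cube
variable {L : ℕ}

def cmix (k : ℕ) (ε ε' : Fin L → Bool) : Fin L → Bool := fun i => if (i : ℕ) < k then ε i else ε' i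

noncomputable def cH (F : (Fin L → Bool) → ℝ) (k : ℕ) (ε : Fin L → Bool) : ℝ :=
  (∑ ε', F (cmix k ε ε')) / 2 ^ L

def cflip (i : Fin L) (ε : Fin L → Bool) : Fin L → Bool := Function.update ε i (!ε i)

lemma cflip_invol (i : Fin L) : Function.Involutive (cflip i) := by
  intro ε
  funext j
  by_cases h : j = i
  · subst h; simp [cflip]
  · simp [cflip, h]

lemma cflip_ne {i j : Fin L} (h : j ≠ i) (ε : Fin L → Bool) : cflip i ε j = ε j := by
  simp [cflip, h]

lemma cflip_eq (i : Fin L) (ε : Fin L → Bool) : cflip i ε i = !ε i := by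
  simp [cflip]

lemma sum_cflip (i : Fin L) (g : (Fin L → Bool) → ℝ) : ∑ ε, g (cflip i ε) = ∑ ε, g ε :=
  Equiv.sum_comp (cflip_invol i).toPerm g

lemma cH_flip (F : (Fin L → Bool) → ℝ) {k : ℕ} (i : Fin L) (h : k ≤ i) (ε : Fin L → Bool) :
    cH F k (cflip i ε) = cH F k ε := by
  unfold cH
  congr 1
  refine Finset.sum_congr rfl fun ε' _ => ?_
  congr 1
  funext j
  unfold cmix
  split_ifs with hj
  · exact cflip_ne (by rintro rfl; omega) _
  · rfl

lemma cH_avg (F : (Fin L → Bool) → ℝ) (i : Fin L) (ε : Fin L → Bool) :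
    cH F (i + 1) ε + cH F (i + 1) (cflip i ε) = 2 * cH F i ε := by
  unfold cH
  rw [← add_div, ← Finset.sum_add_distrib, ← mul_div_assoc]
  congr 1
  rw [two_mul]
  have hfl := sum_cflip i (fun ε' => F (cmix i ε ε'))
  have hfl2 : ∑ ε', F (cmix i ε ε') + ∑ ε', F (cmix i ε ε')
      = ∑ ε', F (cmix i ε ε') + ∑ ε', F (cmix i ε (cflip i ε')) := by rw [hfl]
  rw [hfl2]
  rw [← Finset.sum_add_distrib]
  refine Finset.sum_congr rfl fun ε' _ => ?_
  by_cases h : ε' i = ε i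
  · have e1 : cmix (i + 1) ε ε' = cmix i ε ε' := by
      funext j; unfold cmix
      rcases lt_trichotomy j i with hj | rfl | hj
      · have : (j:ℕ) < i := hj
        rw [if_pos (by omega), if_pos this]
      · simp [h]
      · have : (i:ℕ) < j := hj
        rw [if_neg (by omega), if_neg (by omega)]
    have e2 : cmix (i + 1) (cflip i ε) ε' = cmix i ε (cflip i ε') := by
      funext j; unfold cmix
      rcases lt_trichotomy j i with hj | rfl | hj
      · have : (j:ℕ) < i := hj
        rw [if_pos (by omega), if_pos this, cflip_ne hj.ne]
      · simp [h, cflip_eq]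
      · have : (i:ℕ) < j := hj
        rw [if_neg (by omega), if_neg (by omega), cflip_ne hj.ne']
    rw [e1, e2]
  · have h' : ε' i = !ε i := by revert h; cases ε' i <;> cases ε i <;> simp
    have e1 : cmix (i + 1) ε ε' = cmix i ε (cflip i ε') := by
      funext j; unfold cmix
      rcases lt_trichotomy j i with hj | rfl | hj
      · have : (j:ℕ) < i := hj
        rw [if_pos (by omega), if_pos this]
      · simp [h', cflip_eq]
      · have : (i:ℕ) < j := hj
        rw [if_neg (by omega), if_neg (by omega), cflip_ne hj.ne']
    have e2 : cmix (i + 1) (cflip i ε) ε' = cmix i ε ε' := by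
      funext j; unfold cmix
      rcases lt_trichotomy j i with hj | rfl | hj
      · have : (j:ℕ) < i := hj
        rw [if_pos (by omega), if_pos this, cflip_ne hj.ne]
      · simp [h', cflip_eq]
      · have : (i:ℕ) < j := hj
        rw [if_neg (by omega), if_neg (by omega)]
    rw [e1, e2, add_comm]

lemma cH_top (F : (Fin L → Bool) → ℝ) (ε : Fin L → Bool) : cH F L ε = F ε := by
  unfold cH
  have : ∀ ε', cmix L ε ε' = ε := fun ε' => by funext j; simp [cmix]
  simp [this]

lemma cH_nonneg {F : (Fin L → Bool) → ℝ} (hF : ∀ ε, 0 ≤ F ε) (k : ℕ) (ε : Fin L → Bool) :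
    0 ≤ cH F k ε := div_nonneg (Finset.sum_nonneg fun _ _ => hF _) (by positivity)

open OscSt in
theorem cube_ineq (p : ℝ) (hp : 1 < p) : ∃ C : ℝ, 0 ≤ C ∧ ∀ (L : ℕ) (F : (Fin L → Bool) → ℝ),
    (∀ ε, 0 ≤ F ε) → ∀ R : ℕ → Prop,
    ∑ ε, (reset (p / 2) (run (p / 2) R (fun k => cH F k ε) L)).P ^ (p / 2) ≤ C * ∑ ε, F ε ^ p := by
  obtain ⟨C, Ψ, h, hC, h1, h2, h3, h4⟩ := potential p hp
  refine ⟨C, hC, fun L F hF R => ?_⟩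
  set z : ℕ → (Fin L → Bool) → OscSt := fun k ε => run (p / 2) R (fun k => cH F k ε) k with hz
  have hinv : ∀ k ε, Inv (p / 2) (z k ε) := fun k ε => inv_run (fun k => cH_nonneg hF k ε) k
  have hpost : ∀ k w, Inv (p / 2) w → Ψ (post (p / 2) R k w) ≤ Ψ w := by
    intro k w hw; unfold post; split_ifs
    · exact h3 w hw
    · exact le_rfl
  have main : ∀ k ≤ L, ∑ ε, Ψ (z k ε) ≤ 0 := by
    intro k
    induction k with
    | zero =>
      intro _
      exact Finset.sum_nonpos fun ε _ => h1 _ (cH_nonneg hF 0 ε)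
    | succ k ih =>
      intro hk
      set i : Fin L := ⟨k, hk⟩
      have hzf : ∀ ε, z k (cflip i ε) = z k ε := fun ε =>
        run_congr _ _ _ fun l hl => cH_flip F i hl ε
      set w : (Fin L → Bool) → OscSt := fun ε => post (p / 2) R k (z k ε) with hw
      have hwx : ∀ ε, (w ε).x = cH F k ε := fun ε => by rw [hw]; simp only [post_x, hz, run_x]
      have hav : ∀ ε, cH F (k + 1) ε + cH F (k + 1) (cflip i ε) = 2 * cH F k ε :=
        fun ε => cH_avg F i ε
      have step1 : ∀ ε, Ψ (z (k + 1) ε) ≤ Ψ (z k ε) + h (w ε) * (cH F (k + 1) ε - cH F k ε) := by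
        intro ε
        have a := h2 (w ε) (cH F (k + 1) ε) (inv_post (hinv k ε)) (cH_nonneg hF _ _) (by
          rw [hwx]; linarith [hav ε, cH_nonneg hF (k + 1) (cflip i ε)])
        rw [hwx] at a
        have b := hpost k _ (hinv k ε)
        exact a.trans (by linarith)
      have zero : ∑ ε, h (w ε) * (cH F (k + 1) ε - cH F k ε) = 0 := by
        have e := sum_cflip i (fun ε => h (w ε) * (cH F (k + 1) ε - cH F k ε))
        have e2 : ∀ ε, h (w (cflip i ε)) * (cH F (k + 1) (cflip i ε) - cH F k (cflip i ε))
            = - (h (w ε) * (cH F (k + 1) ε - cH F k ε)) := by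
          intro ε
          have : w (cflip i ε) = w ε := by simp only [hw, hzf]
          rw [this, cH_flip F i (le_refl k) ε]
          have := hav ε
          have : cH F (k + 1) (cflip i ε) = 2 * cH F k ε - cH F (k + 1) ε := by linarith
          rw [this]; ring
        simp only [e2, Finset.sum_neg_distrib] at e
        linarith
      calc ∑ ε, Ψ (z (k + 1) ε) ≤ ∑ ε, (Ψ (z k ε) + h (w ε) * (cH F (k + 1) ε - cH F k ε)) :=
            Finset.sum_le_sum fun ε _ => step1 ε
        _ = ∑ ε, Ψ (z k ε) := by rw [Finset.sum_add_distrib, zero, add_zero]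
        _ ≤ 0 := ih (by omega)
  calc _ ≤ ∑ ε, (Ψ (z L ε) + C * F ε ^ p) := by
        refine Finset.sum_le_sum fun ε _ => ?_
        refine (h4 (z L ε) (hinv L ε)).trans ?_
        have : (reset (p / 2) (z L ε)).x = F ε := by
          have : (reset (p / 2) (z L ε)).x = (z L ε).x := rfl
          rw [this, hz]; simp only [run_x]; exact cH_top F ε
        rw [this]
        linarith [h3 (z L ε) (hinv L ε)]
    _ ≤ _ := by
        rw [Finset.sum_add_distrib, ← Finset.mul_sum]
        linarith [main L le_rfl]

end cube


lemma osc_jensen {Ω : Type*} (S : Finset Ω) (w : Ω → ℝ) (hw : ∀ o ∈ S, 0 ≤ w o)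
    (h1 : ∑ o ∈ S, w o = 1) {p : ℝ} (hp : 1 ≤ p) (J : ℕ) (a : Ω → ℕ → ℝ) :
    (∑ j ∈ Finset.range J, (∑ o ∈ S, w o * a o j) ^ 2) ^ (p / 2) ≤
      ∑ o ∈ S, w o * (∑ j ∈ Finset.range J, a o j ^ 2) ^ (p / 2) := by
  let E : (ℕ → ℝ) → EuclideanSpace ℝ (Fin J) := fun b => WithLp.toLp 2 (fun j => b j)
  have hE : ∀ b : ℕ → ℝ, ∑ j ∈ Finset.range J, b j ^ 2 = ‖E b‖ ^ 2 := by
    intro b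
    rw [EuclideanSpace.norm_sq_eq, ← Fin.sum_univ_eq_sum_range (fun j => b j ^ 2)]
    simp [E]
  have hE2 : ∀ b : ℕ → ℝ, (∑ j ∈ Finset.range J, b j ^ 2) ^ (p / 2) = ‖E b‖ ^ p := by
    intro b
    rw [hE, ← Real.rpow_natCast, ← Real.rpow_mul (norm_nonneg _)]; congr 1; push_cast; ring
  have hsum : E (fun j => ∑ o ∈ S, w o * a o j) = ∑ o ∈ S, w o • E (a o) := by
    ext j; simp [E]
  rw [hE2, hsum]
  simp only [hE2]
  calc ‖∑ o ∈ S, w o • E (a o)‖ ^ p ≤ (∑ o ∈ S, w o * ‖E (a o)‖) ^ p := by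
        refine Real.rpow_le_rpow (norm_nonneg _) ?_ (by linarith)
        refine (norm_sum_le _ _).trans (le_of_eq (Finset.sum_congr rfl fun o ho => ?_))
        rw [norm_smul, Real.norm_of_nonneg (hw o ho)]
    _ ≤ _ := Real.rpow_arith_mean_le_arith_mean_rpow S w _ hw h1 (fun _ _ => norm_nonneg _) hp

section grp
variable {V : Type*} [AddCommGroup V]

def oTr : Multiplicative V →* Module.End ℝ (V → ℝ) where
  toFun n :=
    { toFun := fun f y => f (y + n.toAdd)
      map_add' := fun f g => rfl
      map_smul' := fun c f => rfl }
  map_one' := by ext f y; simp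
  map_mul' := fun m n => by
    ext f y
    simp only [LinearMap.coe_mk, AddHom.coe_mk, Module.End.mul_apply, toAdd_mul]
    congr 1; abel

noncomputable def oAct (f : V → ℝ) (y : V) (a : AddMonoidAlgebra ℝ V) : ℝ :=
  (AddMonoidAlgebra.lift ℝ (Module.End ℝ (V → ℝ)) V oTr a) f y

lemma oAct_sum {ι : Type*} (f : V → ℝ) (y : V) (S : Finset ι) (a : ι → AddMonoidAlgebra ℝ V) :
    oAct f y (∑ i ∈ S, a i) = ∑ i ∈ S, oAct f y (a i) := by
  simp [oAct, map_sum]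

lemma oAct_smul (f : V → ℝ) (y : V) (c : ℝ) (a : AddMonoidAlgebra ℝ V) :
    oAct f y (c • a) = c * oAct f y a := by
  simp [oAct]

noncomputable def oδ (n : V) : AddMonoidAlgebra ℝ V := AddMonoidAlgebra.single n 1

lemma oδ_zero : oδ (0 : V) = 1 := rfl

lemma oδ_add (m n : V) : oδ (m + n) = oδ m * oδ n := by
  simp [oδ, AddMonoidAlgebra.single_mul_single]

lemma oδ_sum {ι : Type*} (S : Finset ι) (v : ι → V) : oδ (∑ i ∈ S, v i) = ∏ i ∈ S, oδ (v i) := by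
  classical
  induction S using Finset.induction_on with
  | empty => simp [oδ_zero]
  | insert a s ha ih => rw [Finset.sum_insert ha, Finset.prod_insert ha, oδ_add, ih]

lemma oAct_δ (f : V → ℝ) (y n : V) : oAct f y (oδ n) = f (y + n) := by
  simp [oAct, oδ, AddMonoidAlgebra.lift_single, oTr]

noncomputable def oq (v : V) : AddMonoidAlgebra ℝ V :=
  ((1 / 4 : ℝ)) • ((oδ 0 + oδ v) * (oδ 0 + oδ (-v)))

lemma oq_zero : oq (0 : V) = 1 := by
  simp only [oq, neg_zero, oδ_zero]
  have h : (1 + 1 : AddMonoidAlgebra ℝ V) * (1 + 1) = (4 : ℝ) • 1 := by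
    rw [mul_add, mul_one]; module
  rw [h, smul_smul]; norm_num

def obs (b : Bool) (v : V) : V := if b then v else 0

noncomputable def oA {L : ℕ} (v : Fin L → V) (k : ℕ) : AddMonoidAlgebra ℝ V :=
  ∏ i : Fin L, oq (if (i : ℕ) < k then 0 else v i)

lemma oAct_prod {L : ℕ} (w : Fin L → V) (f : V → ℝ) (y : V) :
    oAct f y (∏ i, oq (w i)) = ∑ ε : Fin L → Bool, (1 / 2 ^ L) *
      ((∑ ε' : Fin L → Bool, f (y - ∑ i, obs (ε i) (w i) + ∑ i, obs (ε' i) (w i))) / 2 ^ L) := by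
  have e : ∀ i, oq (w i) = (1 / 4 : ℝ) •
      ((∑ b : Bool, oδ (obs b (w i))) * ∑ b : Bool, oδ (-obs b (w i))) := by
    intro i
    simp only [oq, Fintype.univ_bool, Finset.mem_singleton, Bool.true_eq_false, not_false_eq_true,
      Finset.sum_insert, Finset.sum_singleton, obs]
    simp [add_comm]
  simp only [e]
  rw [Finset.prod_smul, Finset.prod_mul_distrib, Fintype.prod_sum, Fintype.prod_sum,
    mul_comm, Finset.sum_mul_sum]
  simp only [← oδ_sum, ← oδ_add]
  rw [oAct_smul, oAct_sum, Finset.mul_sum]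
  refine Finset.sum_congr rfl fun ε _ => ?_
  rw [oAct_sum]
  simp only [oAct_δ]
  have : ∀ ε' : Fin L → Bool, y - ∑ i, obs (ε i) (w i) + ∑ i, obs (ε' i) (w i)
      = y + (∑ i, -obs (ε i) (w i) + ∑ i, obs (ε' i) (w i)) := by
    intro ε'; rw [Finset.sum_neg_distrib]; abel
  simp only [this]
  simp only [Finset.prod_const, Finset.card_univ, Fintype.card_fin]
  rw [show ((1 / 4 : ℝ)) ^ L = 1 / 2 ^ L * (1 / 2 ^ L) by
    rw [div_mul_div_comm, ← mul_pow, one_mul, one_div_pow]; norm_num]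
  ring

lemma oAct_A {L : ℕ} (v : Fin L → V) (f : V → ℝ) (y : V) (k : ℕ) :
    oAct f y (oA v k) = ∑ ε : Fin L → Bool, (1 / 2 ^ L) *
      cH (fun ε' => f (y - ∑ i, obs (ε i) (v i) + ∑ i, obs (ε' i) (v i))) k ε := by
  unfold oA
  rw [oAct_prod]
  refine Finset.sum_congr rfl fun ε _ => ?_
  congr 1
  unfold cH
  congr 1
  refine Finset.sum_congr rfl fun ε' _ => ?_
  congr 1
  rw [sub_add, sub_add, ← Finset.sum_sub_distrib, ← Finset.sum_sub_distrib]
  congr 1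
  refine Finset.sum_congr rfl fun i _ => ?_
  unfold cmix
  split_ifs
  · simp [obs]
  · rfl

end grp

set_option maxHeartbeats 1000000 in
open OscSt in
theorem grp_ineq (p : ℝ) (hp : 1 < p) : ∃ C : ℝ, 0 ≤ C ∧ ∀ (V : Type) [AddCommGroup V] (L : ℕ)
    (v : Fin L → V) (f : V → ℝ), (∀ x, 0 ≤ f x) → Summable (fun x => f x ^ p) →
    ∀ (b : ℕ → ℕ), Antitone b → (∀ j, b j ≤ L) → ∀ (J : ℕ) (κ : V → ℕ → ℕ),
    (∀ y, ∀ j < J, b (j + 1) ≤ κ y j) → (∀ y, ∀ j < J, κ y j ≤ b j) → ∀ Y : Finset V,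
    ∑ y ∈ Y, (∑ j ∈ Finset.range J, (oAct f y (oA v (κ y j)) - oAct f y (oA v (b j))) ^ 2) ^ (p / 2)
      ≤ C * ∑' x, f x ^ p := by
  obtain ⟨C, hC, H⟩ := cube_ineq p hp
  refine ⟨4 ^ (p / 2) * C, by positivity, ?_⟩
  intro V _ L v f hf hs b hb hbL J κ h1 h2 Y
  set S : (Fin L → Bool) → V := fun ε => ∑ i, obs (ε i) (v i) with hS
  set R : ℕ → Prop := fun k => ∃ j, b j = k with hR
  set g : V → (Fin L → Bool) → ℝ := fun x ε =>
    (reset (p / 2) (run (p / 2) R (fun k => cH (fun ε' => f (x + S ε')) k ε) L)).P with hg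
  have hg0 : ∀ x ε, 0 ≤ g x ε := fun x ε =>
    (inv_reset (inv_run (fun k => cH_nonneg (fun _ => hf _) k ε) L)).hP
  have hgp0 : ∀ x ε, 0 ≤ g x ε ^ (p / 2) := fun x ε => Real.rpow_nonneg (hg0 x ε) _
  have hgs : ∀ x, ∑ ε, g x ε ^ (p / 2) ≤ C * ∑ ε, f (x + S ε) ^ p := fun x =>
    H L (fun ε' => f (x + S ε')) (fun _ => hf _) R
  have hshift : ∀ ε, Summable (fun x => f (x + S ε) ^ p) := fun ε =>
    (Equiv.addRight (S ε)).summable_iff.2 hs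
  have hsh : ∀ ε, ∑' x, f (x + S ε) ^ p = ∑' x, f x ^ p := fun ε =>
    (Equiv.addRight (S ε)).tsum_eq (fun x => f x ^ p)
  have hsumR : Summable (fun x => C * ∑ ε, f (x + S ε) ^ p) :=
    (summable_sum fun ε _ => hshift ε).mul_left C
  have hgsum : ∀ ε, Summable (fun x => g x ε ^ (p / 2)) := fun ε =>
    Summable.of_nonneg_of_le (fun x => hgp0 x ε)
      (fun x => (Finset.single_le_sum (fun ε _ => hgp0 x ε) (Finset.mem_univ ε)).trans (hgs x)) hsumR
  have hgt : ∑ ε, ∑' x, g x ε ^ (p / 2) ≤ C * (2 ^ L * ∑' x, f x ^ p) := by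
    rw [← Summable.tsum_finsetSum (fun ε _ => hgsum ε)]
    calc _ ≤ ∑' x, C * ∑ ε, f (x + S ε) ^ p :=
          Summable.tsum_le_tsum hgs (summable_sum fun ε _ => hgsum ε) hsumR
      _ = _ := by
          rw [tsum_mul_left, Summable.tsum_finsetSum (fun ε _ => hshift ε)]
          simp [hsh]
  have hpt : ∀ y, (∑ j ∈ Finset.range J,
      (oAct f y (oA v (κ y j)) - oAct f y (oA v (b j))) ^ 2) ^ (p / 2) ≤
      ∑ ε : Fin L → Bool, (1 / 2 ^ L) * (4 ^ (p / 2) * g (y - S ε) ε ^ (p / 2)) := by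
    intro y
    have e : ∀ j, oAct f y (oA v (κ y j)) - oAct f y (oA v (b j)) =
        ∑ ε : Fin L → Bool, (1 / 2 ^ L) *
          (cH (fun ε' => f (y - S ε + S ε')) (κ y j) ε - cH (fun ε' => f (y - S ε + S ε')) (b j) ε) := by
      intro j
      rw [oAct_A, oAct_A, ← Finset.sum_sub_distrib]
      exact Finset.sum_congr rfl fun ε _ => by rw [mul_sub]
    simp only [e]
    refine (osc_jensen Finset.univ (fun _ => 1 / 2 ^ L) (fun _ _ => by positivity)
      (by simp) hp.le J
      (fun ε j => cH (fun ε' => f (y - S ε + S ε')) (κ y j) ε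
        - cH (fun ε' => f (y - S ε + S ε')) (b j) ε)).trans ?_
    refine Finset.sum_le_sum fun ε _ => ?_
    refine mul_le_mul_of_nonneg_left ?_ (by positivity)
    rw [← Real.mul_rpow (by norm_num) (hg0 _ _)]
    refine Real.rpow_le_rpow (Finset.sum_nonneg fun _ _ => sq_nonneg _) ?_ (by linarith)
    exact osc_bound (p / 2) (X := fun k => cH (fun ε' => f (y - S ε + S ε')) k ε) hb hbL
      (h1 y) (h2 y) (fun k => cH_nonneg (fun _ => hf _) k ε)
  calc _ ≤ ∑ y ∈ Y, ∑ ε : Fin L → Bool, (1 / 2 ^ L) * (4 ^ (p / 2) * g (y - S ε) ε ^ (p / 2)) :=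
        Finset.sum_le_sum fun y _ => hpt y
    _ = (1 / 2 ^ L) * 4 ^ (p / 2) * ∑ ε : Fin L → Bool, ∑ y ∈ Y, g (y - S ε) ε ^ (p / 2) := by
        rw [Finset.sum_comm, Finset.mul_sum]
        refine Finset.sum_congr rfl fun ε _ => ?_
        rw [Finset.mul_sum]
        refine Finset.sum_congr rfl fun y _ => ?_
        ring
    _ ≤ (1 / 2 ^ L) * 4 ^ (p / 2) * ∑ ε : Fin L → Bool, ∑' x, g x ε ^ (p / 2) := by
        refine mul_le_mul_of_nonneg_left ?_ (by positivity)
        refine Finset.sum_le_sum fun ε _ => ?_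
        rw [← (Equiv.subRight (S ε)).tsum_eq (fun x => g x ε ^ (p / 2))]
        exact Summable.sum_le_tsum Y (fun y _ => hgp0 _ _)
          ((Equiv.subRight (S ε)).summable_iff.2 (hgsum ε))
    _ ≤ (1 / 2 ^ L) * 4 ^ (p / 2) * (C * (2 ^ L * ∑' x, f x ^ p)) :=
        mul_le_mul_of_nonneg_left hgt (by positivity)
    _ = _ := by field_simp



section thmD

noncomputable def dC (N : ℕ) (c : ℕ → ℝ) (τ : ℕ) : ℝ :=
  if τ = 0 then 1 else if τ ≤ N + 1 then c (τ - 1) else 0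

lemma dC_anti (N : ℕ) (c : ℕ → ℝ) (hc : Antitone c) (h0 : ∀ n, 0 ≤ c n) (h1 : ∀ n, c n ≤ 1) (τ : ℕ) :
    0 ≤ dC N c τ - dC N c (τ + 1) := by
  unfold dC
  rcases Nat.eq_zero_or_pos τ with rfl | h
  · simp; exact h1 0
  · have := hc (show τ - 1 ≤ τ by omega)
    have := h0 (τ - 1)
    have h' : τ ≠ 0 := by omega
    simp only [h', if_false, Nat.add_eq_zero_iff, one_ne_zero, and_false, Nat.add_sub_cancel]
    split_ifs <;> linarith

lemma dC_sum {E : Type*} [AddCommGroup E] [Module ℝ E] (N : ℕ) (c : ℕ → ℝ) (X Y : E) (n : ℕ)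
    (hn : n ≤ N) :
    ∑ τ : Fin (N + 2), (dC N c τ - dC N c (τ + 1)) • (if (τ : ℕ) ≤ n then X else Y) =
      (1 - c n) • X + c n • Y := by
  rw [Fin.sum_univ_eq_sum_range
    (fun τ => (dC N c τ - dC N c (τ + 1)) • (if (τ : ℕ) ≤ n then X else Y)) (N + 2)]
  set F : ℕ → E := fun τ => if τ ≤ n then dC N c τ • X - c n • X + c n • Y else dC N c τ • Y with hF
  have e : ∀ τ, (dC N c τ - dC N c (τ + 1)) • (if (τ : ℕ) ≤ n then X else Y) = F τ - F (τ + 1) := by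
    intro τ
    simp only [hF]
    rcases lt_trichotomy τ n with h | h | h
    · rw [if_pos h.le, if_pos h.le, if_pos (by omega)]; module
    · subst h
      have : dC N c (τ + 1) = c τ := by
        simp [dC, hn]
      rw [if_pos le_rfl, if_pos le_rfl, if_neg (by omega), this]; module
    · rw [if_neg (by omega), if_neg (by omega), if_neg (by omega)]; module
  rw [Finset.sum_congr rfl fun τ _ => e τ, Finset.sum_range_sub']
  simp only [hF]
  rw [if_pos (Nat.zero_le _), if_neg (by omega)]
  simp only [dC, if_true]
  rw [if_neg (by omega), if_neg (by omega)]
  module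

def dcut {L : ℕ} (m : Fin L → ℕ) (n : ℕ) : ℕ := (Finset.univ.filter fun j => m j ≤ n).card

lemma dcut_le {L : ℕ} (m : Fin L → ℕ) (n : ℕ) : dcut m n ≤ L :=
  (Finset.card_le_univ _).trans (by simp)

lemma dcut_mono {L : ℕ} (m : Fin L → ℕ) : Monotone (dcut m) := by
  intro a b h
  refine Finset.card_le_card fun j => ?_
  simp only [Finset.mem_filter, Finset.mem_univ, true_and]
  omega

lemma lt_dcut {L : ℕ} (m : Fin L → ℕ) (hm : Monotone m) (n : ℕ) (i : Fin L) :
    (i : ℕ) < dcut m n ↔ m i ≤ n := by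
  constructor
  · intro h
    by_contra h'
    have : dcut m n ≤ (Finset.Iio i).card := by
      refine Finset.card_le_card fun j => ?_
      simp only [Finset.mem_filter, Finset.mem_univ, true_and, Finset.mem_Iio]
      intro hj
      by_contra h2
      have := hm (not_lt.1 h2)
      omega
    rw [Fin.card_Iio] at this
    omega
  · intro h
    have : (Finset.Iic i).card ≤ dcut m n := by
      refine Finset.card_le_card fun j => ?_
      simp only [Finset.mem_filter, Finset.mem_univ, true_and, Finset.mem_Iic]
      intro hj
      have := hm hj
      omega
    rw [Fin.card_Iic] at this
    omega

theorem thmD (p : ℝ) (hp : 1 < p) : ∃ C : ℝ, 0 ≤ C ∧ ∀ (V : Type) [AddCommGroup V] (L : ℕ)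
    (e : Fin L → V) (c : Fin L → ℕ → ℝ), (∀ i, Antitone (c i)) → (∀ i n, 0 ≤ c i n) →
    (∀ i n, c i n ≤ 1) → ∀ (f : V → ℝ), (∀ x, 0 ≤ f x) → Summable (fun x => f x ^ p) →
    ∀ (β : ℕ → ℕ), Antitone β → ∀ (J : ℕ) (κ : V → ℕ → ℕ),
    (∀ y, ∀ j < J, β (j + 1) ≤ κ y j) → (∀ y, ∀ j < J, κ y j ≤ β j) → ∀ Y : Finset V,
    ∑ y ∈ Y, (∑ j ∈ Finset.range J,
      (oAct f y (∏ i, ((1 - c i (κ y j)) • (1 : AddMonoidAlgebra ℝ V) + c i (κ y j) • oq (e i)))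
       - oAct f y (∏ i, ((1 - c i (β j)) • (1 : AddMonoidAlgebra ℝ V) + c i (β j) • oq (e i)))) ^ 2) ^ (p / 2)
      ≤ C * ∑' x, f x ^ p := by
  obtain ⟨C, hC, H⟩ := grp_ineq p hp
  refine ⟨C, hC, ?_⟩
  intro V _ L e c hca hc0 hc1 f hf hs β hβ J κ h1 h2 Y
  set N := β 0 with hN
  have hβN : ∀ j, β j ≤ N := fun j => hβ (Nat.zero_le j)
  set w : (Fin L → Fin (N + 2)) → ℝ := fun τ => ∏ i, (dC N (c i) (τ i) - dC N (c i) (τ i + 1)) with hw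
  have hw0 : ∀ τ, 0 ≤ w τ := fun τ => Finset.prod_nonneg fun i _ =>
    dC_anti N (c i) (hca i) (hc0 i) (hc1 i) _
  have hw1 : ∑ τ, w τ = 1 := by
    rw [hw, ← Fintype.prod_sum (fun i (t : Fin (N + 2)) => dC N (c i) t - dC N (c i) (t + 1))]
    refine Finset.prod_eq_one fun i _ => ?_
    have := dC_sum N (c i) (1 : ℝ) 1 0 (Nat.zero_le _)
    simpa using this
  set m : (Fin L → Fin (N + 2)) → Fin L → ℕ := fun τ i => (τ (Tuple.sort τ i) : ℕ) with hm
  have hmm : ∀ τ, Monotone (m τ) := fun τ a b hab => Tuple.monotone_sort τ hab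
  have key : ∀ y n, n ≤ N →
      oAct f y (∏ i, ((1 - c i n) • (1 : AddMonoidAlgebra ℝ V) + c i n • oq (e i))) =
      ∑ τ, w τ * oAct f y (oA (e ∘ Tuple.sort τ) (dcut (m τ) n)) := by
    intro y n hn
    have e1 : ∀ i, (1 - c i n) • (1 : AddMonoidAlgebra ℝ V) + c i n • oq (e i) =
        ∑ t : Fin (N + 2), (dC N (c i) t - dC N (c i) (t + 1)) •
          (if (t : ℕ) ≤ n then (1 : AddMonoidAlgebra ℝ V) else oq (e i)) :=
      fun i => (dC_sum N (c i) _ _ n hn).symm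
    simp only [e1]
    rw [Fintype.prod_sum, oAct_sum]
    refine Finset.sum_congr rfl fun τ _ => ?_
    rw [Finset.prod_smul, oAct_smul]
    congr 2
    unfold oA
    rw [← Equiv.prod_comp (Tuple.sort τ)]
    refine Finset.prod_congr rfl fun i _ => ?_
    have h3 := lt_dcut (m τ) (hmm τ) n i
    by_cases h4 : m τ i ≤ n
    · rw [if_pos (h3.2 h4), oq_zero]; exact if_pos h4
    · rw [if_neg (fun h => h4 (h3.1 h))]; exact if_neg h4
  have hpt : ∀ y, (∑ j ∈ Finset.range J,
      (oAct f y (∏ i, ((1 - c i (κ y j)) • (1 : AddMonoidAlgebra ℝ V) + c i (κ y j) • oq (e i)))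
       - oAct f y (∏ i, ((1 - c i (β j)) • (1 : AddMonoidAlgebra ℝ V) + c i (β j) • oq (e i)))) ^ 2) ^ (p / 2)
      ≤ ∑ τ, w τ * (∑ j ∈ Finset.range J,
        (oAct f y (oA (e ∘ Tuple.sort τ) (dcut (m τ) (κ y j)))
          - oAct f y (oA (e ∘ Tuple.sort τ) (dcut (m τ) (β j)))) ^ 2) ^ (p / 2) := by
    intro y
    have e2 := osc_jensen Finset.univ w (fun τ _ => hw0 τ) hw1 hp.le J
      (fun τ j => oAct f y (oA (e ∘ Tuple.sort τ) (dcut (m τ) (κ y j)))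
          - oAct f y (oA (e ∘ Tuple.sort τ) (dcut (m τ) (β j))))
    refine le_trans (le_of_eq ?_) e2
    congr 1
    refine Finset.sum_congr rfl fun j hj => ?_
    rw [Finset.mem_range] at hj
    rw [key y _ ((h2 y j hj).trans (hβN j)), key y _ (hβN j), ← Finset.sum_sub_distrib]
    congr 1
    exact Finset.sum_congr rfl fun τ _ => by rw [mul_sub]
  calc _ ≤ ∑ y ∈ Y, ∑ τ, w τ * (∑ j ∈ Finset.range J,
        (oAct f y (oA (e ∘ Tuple.sort τ) (dcut (m τ) (κ y j)))
          - oAct f y (oA (e ∘ Tuple.sort τ) (dcut (m τ) (β j)))) ^ 2) ^ (p / 2) :=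
        Finset.sum_le_sum fun y _ => hpt y
    _ = ∑ τ, w τ * ∑ y ∈ Y, (∑ j ∈ Finset.range J,
        (oAct f y (oA (e ∘ Tuple.sort τ) (dcut (m τ) (κ y j)))
          - oAct f y (oA (e ∘ Tuple.sort τ) (dcut (m τ) (β j)))) ^ 2) ^ (p / 2) := by
        rw [Finset.sum_comm]
        exact Finset.sum_congr rfl fun τ _ => by rw [Finset.mul_sum]
    _ ≤ ∑ τ, w τ * (C * ∑' x, f x ^ p) := by
        refine Finset.sum_le_sum fun τ _ => mul_le_mul_of_nonneg_left ?_ (hw0 τ)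
        exact H V L (e ∘ Tuple.sort τ) f hf hs (fun j => dcut (m τ) (β j))
          (fun a b hab => dcut_mono _ (hβ hab)) (fun j => dcut_le _ _) J
          (fun y j => dcut (m τ) (κ y j))
          (fun y j hj => dcut_mono _ (h1 y j hj)) (fun y j hj => dcut_mono _ (h2 y j hj)) Y
    _ = _ := by rw [← Finset.sum_mul, hw1, one_mul]

end thmD


section kern

noncomputable def eDn (q : ℝ) (k : ℕ) : ℝ := ∏ i ∈ Finset.range k, (1 - q ^ (2 * (i + 1)))⁻¹

noncomputable def eD (q : ℝ) (k : ℤ) : ℝ := if k < 0 then 0 else eDn q k.toNat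

variable {q : ℝ}

lemma one_sub_pos' (h0 : 0 < q) (h1 : q < 1) (n : ℕ) : 0 < 1 - q ^ (n + 1) := by
  have := pow_lt_one₀ h0.le h1 (Nat.succ_ne_zero n)
  simp only [Nat.succ_eq_add_one] at this
  linarith

lemma eDn_fac (h0 : 0 < q) (h1 : q < 1) (i : ℕ) : 1 ≤ (1 - q ^ (2 * (i + 1)))⁻¹ := by
  have h := one_sub_pos' h0 h1 (2 * i + 1)
  have e : 2 * (i + 1) = 2 * i + 1 + 1 := by ring
  rw [e]
  rw [one_le_inv₀ h]
  have := pow_pos h0 (2 * i + 1 + 1)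
  linarith

lemma eDn_succ (k : ℕ) : eDn q (k + 1) = eDn q k * (1 - q ^ (2 * (k + 1)))⁻¹ :=
  Finset.prod_range_succ _ _

lemma eDn_one_le (h0 : 0 < q) (h1 : q < 1) (k : ℕ) : 1 ≤ eDn q k := by
  induction k with
  | zero => simp [eDn]
  | succ k ih => rw [eDn_succ]; nlinarith [eDn_fac h0 h1 k]

lemma eDn_mono (h0 : 0 < q) (h1 : q < 1) : Monotone (eDn q) := by
  refine monotone_nat_of_le_succ fun k => ?_
  rw [eDn_succ]; nlinarith [eDn_fac h0 h1 k, eDn_one_le h0 h1 k]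

lemma eDn_bdd (h0 : 0 < q) (h1 : q < 1) : ∃ B : ℝ, ∀ k, eDn q k ≤ B := by
  have hs : Summable (fun i : ℕ => q ^ i * (1 - q)⁻¹) :=
    (summable_geometric_of_lt_one h0.le h1).mul_right _
  refine ⟨Real.exp (∑' i, q ^ i * (1 - q)⁻¹), fun k => ?_⟩
  have : eDn q k ≤ Real.exp (∑ i ∈ Finset.range k, q ^ i * (1 - q)⁻¹) := by
    rw [Real.exp_sum]
    refine Finset.prod_le_prod (fun i _ => zero_le_one.trans (eDn_fac h0 h1 i)) fun i _ => ?_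
    have h := one_sub_pos' h0 h1 (2 * i + 1)
    have e : 2 * (i + 1) = 2 * i + 1 + 1 := by ring
    rw [e]
    refine le_trans ?_ (Real.add_one_le_exp _)
    have hq : 0 < 1 - q := by linarith
    have a1 : q ^ (2 * i + 1 + 1) ≤ q ^ i := pow_le_pow_of_le_one h0.le h1.le (by omega)
    have a2 : q ^ (2 * i + 1 + 1) ≤ q := by
      simpa using pow_le_pow_of_le_one h0.le h1.le (show 1 ≤ 2 * i + 1 + 1 by omega)
    have e2 : (1 - q ^ (2 * i + 1 + 1))⁻¹ = q ^ (2 * i + 1 + 1) * (1 - q ^ (2 * i + 1 + 1))⁻¹ + 1 := by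
      field_simp; ring
    rw [e2]
    gcongr
  refine this.trans (Real.exp_le_exp.2 (hs.sum_le_tsum _ fun i _ => ?_))
  have hq : 0 < 1 - q := by linarith
  positivity

lemma eD_nat (k : ℕ) : eD q k = eDn q k := by simp [eD]

lemma eD_rec (h0 : 0 < q) (h1 : q < 1) (k : ℤ) : eD q (k - 1) = (1 - q ^ (2 * k)) * eD q k := by
  rcases lt_trichotomy k 0 with h | h | h
  · simp [eD, h, show k - 1 < 0 by omega]
  · subst h; simp [eD]
  · obtain ⟨n, rfl⟩ : ∃ n : ℕ, k = (n + 1 : ℕ) := ⟨k.toNat - 1, by omega⟩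
    rw [show ((n + 1 : ℕ) : ℤ) - 1 = (n : ℕ) by push_cast; ring, eD_nat, eD_nat, eDn_succ]
    have h := one_sub_pos' h0 h1 (2 * n + 1)
    rw [show (q : ℝ) ^ (2 * ((n + 1 : ℕ) : ℤ)) = q ^ (2 * (n + 1)) by
      rw [← zpow_natCast]; push_cast; rfl]
    have e : 2 * (n + 1) = 2 * n + 1 + 1 := by ring
    rw [e]
    field_simp

noncomputable def ea (q : ℝ) (M : ℕ) (n : ℤ) : ℝ := q ^ (n * n) * (eD q (M + n) * eD q (M - n))

lemma ea_zero_of (M : ℕ) (n : ℤ) (h : n ∉ Finset.Icc (-(M : ℤ)) M) : ea q M n = 0 := by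
  rw [Finset.mem_Icc] at h
  unfold ea eD
  by_cases h2 : (M : ℤ) + n < 0
  · simp [h2]
  · have : (M : ℤ) - n < 0 := by omega
    simp [this]

lemma ea_rec (h0 : 0 < q) (h1 : q < 1) (M : ℕ) (n : ℤ) :
    (1 - q ^ (4 * M + 2)) * (1 - q ^ (4 * M + 4)) * ea q (M + 1) n =
      (1 + q ^ (4 * M + 2)) * ea q M n + q ^ (2 * M + 1) * (ea q M (n - 1) + ea q M (n + 1)) := by
  unfold ea
  set A := eD q ((M + 1 : ℕ) + n) with hA
  set B := eD q ((M + 1 : ℕ) - n) with hB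
  have hq : q ≠ 0 := h0.ne'
  have e1 : eD q (M + n) = (1 - q ^ (2 * ((M + 1 : ℕ) + n))) * A := by
    rw [hA, ← eD_rec h0 h1]; congr 1; push_cast; ring
  have e2 : eD q (M - n) = (1 - q ^ (2 * ((M + 1 : ℕ) - n))) * B := by
    rw [hB, ← eD_rec h0 h1]; congr 1; push_cast; ring
  have e3 : eD q (M + (n - 1)) = (1 - q ^ (2 * (M + n))) * ((1 - q ^ (2 * ((M + 1 : ℕ) + n))) * A) := by
    rw [← e1, ← eD_rec h0 h1]; congr 1; ring
  have e4 : eD q (M - (n + 1)) = (1 - q ^ (2 * (M - n))) * ((1 - q ^ (2 * ((M + 1 : ℕ) - n))) * B) := by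
    rw [← e2, ← eD_rec h0 h1]; congr 1; ring
  have e5 : eD q (M - (n - 1)) = B := by rw [hB]; congr 1; push_cast; ring
  have e6 : eD q (M + (n + 1)) = A := by rw [hA]; congr 1; push_cast; ring
  rw [e1, e2, e3, e4, e5, e6]
  set x := q ^ n with hx
  set y := q ^ M with hy
  have hx0 : x ≠ 0 := zpow_ne_zero _ hq
  have f1 : q ^ (2 * (((M + 1 : ℕ) : ℤ) + n)) = y ^ 2 * q ^ 2 * x ^ 2 := by
    rw [hx, hy, mul_add, zpow_add₀ hq, mul_comm 2 n, zpow_mul q n 2]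
    norm_cast; ring
  have f2 : q ^ (2 * (((M + 1 : ℕ) : ℤ) - n)) = y ^ 2 * q ^ 2 / x ^ 2 := by
    rw [hx, hy, mul_sub, zpow_sub₀ hq, mul_comm 2 n, zpow_mul q n 2]
    norm_cast; ring
  have f3 : q ^ (2 * ((M : ℤ) + n)) = y ^ 2 * x ^ 2 := by
    rw [hx, hy, mul_add, zpow_add₀ hq, mul_comm 2 n, zpow_mul q n 2]
    norm_cast; ring
  have f4 : q ^ (2 * ((M : ℤ) - n)) = y ^ 2 / x ^ 2 := by
    rw [hx, hy, mul_sub, zpow_sub₀ hq, mul_comm 2 n, zpow_mul q n 2]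
    norm_cast; ring
  have f5 : q ^ ((n - 1) * (n - 1)) = q ^ (n * n) * q / x ^ 2 := by
    rw [show (n - 1) * (n - 1) = n * n + 1 - n * 2 by ring, zpow_sub₀ hq, zpow_add₀ hq, zpow_mul q n 2,
      zpow_one]
    norm_cast
  have f6 : q ^ ((n + 1) * (n + 1)) = q ^ (n * n) * q * x ^ 2 := by
    rw [show (n + 1) * (n + 1) = n * n + 1 + n * 2 by ring, zpow_add₀ hq, zpow_add₀ hq, zpow_mul q n 2,
      zpow_one]
    norm_cast
  have f7 : q ^ (4 * M + 2) = y ^ 4 * q ^ 2 := by rw [hy]; ring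
  have f8 : q ^ (4 * M + 4) = y ^ 4 * q ^ 4 := by rw [hy]; ring
  have f9 : q ^ (2 * M + 1) = y ^ 2 * q := by rw [hy]; ring
  rw [f1, f2, f3, f4, f5, f6, f7, f8, f9]
  field_simp
  ring

noncomputable def eb (q : ℝ) (m : ℕ) : ℝ := 4 * q ^ (2 * m + 1) / (1 + q ^ (2 * m + 1)) ^ 2

noncomputable def er (q : ℝ) (M : ℕ) : ℝ :=
  ∏ m ∈ Finset.range M, ((1 - q ^ (4 * m + 2)) * (1 - q ^ (4 * m + 4)) / (1 + q ^ (2 * m + 1)) ^ 2)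

noncomputable def ek (q : ℝ) (M : ℕ) (n : ℤ) : ℝ := er q M * ea q M n

lemma ek_zero_of (M : ℕ) (n : ℤ) (h : n ∉ Finset.Icc (-(M : ℤ)) M) : ek q M n = 0 := by
  rw [ek, ea_zero_of M n h, mul_zero]

lemma ek_rec (h0 : 0 < q) (h1 : q < 1) (M : ℕ) (n : ℤ) :
    ek q (M + 1) n = (1 - eb q M / 2) * ek q M n + eb q M / 4 * (ek q M (n - 1) + ek q M (n + 1)) := by
  have h := ea_rec h0 h1 M n
  have e : er q (M + 1) = er q M * ((1 - q ^ (4 * M + 2)) * (1 - q ^ (4 * M + 4)) / (1 + q ^ (2 * M + 1)) ^ 2) :=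
    Finset.prod_range_succ _ _
  unfold ek eb
  have hb : 0 < q ^ (2 * M + 1) := by positivity
  have e2 : q ^ (4 * M + 2) = (q ^ (2 * M + 1)) ^ 2 := by ring
  rw [e]
  calc _ = er q M * ((1 - q ^ (4 * M + 2)) * (1 - q ^ (4 * M + 4)) * ea q (M + 1) n) / (1 + q ^ (2 * M + 1)) ^ 2 := by ring
    _ = _ := by rw [h, e2]; field_simp; ring

lemma sum_shift {A : Type*} [AddCommGroup A] [Module ℝ A] (k : ℤ → ℝ) (g : ℤ → A) (a b a' b' s : ℤ)
    (hk : ∀ n, n ∉ Finset.Icc a b → k n = 0) (ha : a' ≤ a + s) (hb : b + s ≤ b') :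
    ∑ n ∈ Finset.Icc a' b', k (n - s) • g n = ∑ n ∈ Finset.Icc a b, k n • g (n + s) := by
  have : ∑ n ∈ Finset.Icc a b, k n • g (n + s) = ∑ n ∈ Finset.Icc (a + s) (b + s), k (n - s) • g n := by
    rw [← Finset.map_add_right_Icc, Finset.sum_map]
    simp
  rw [this]
  symm
  refine Finset.sum_subset (Finset.Icc_subset_Icc ha hb) fun n _ hn => ?_
  rw [hk, zero_smul]
  rw [Finset.mem_Icc] at hn ⊢
  omega

lemma ek_prod {A : Type*} [CommRing A] [Algebra ℝ A] (h0 : 0 < q) (h1 : q < 1) (z w : A) (g : ℤ → A)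
    (hzw : z * w = 1) (g0 : g 0 = 1) (g1 : ∀ n, g (n + 1) = g n * z) (g2 : ∀ n, g (n + -1) = g n * w) (M : ℕ) :
    ∏ m ∈ Finset.range M, ((1 - eb q m) • (1 : A) + eb q m • ((1 / 4 : ℝ) • ((1 + z) * (1 + w)))) =
      ∑ n ∈ Finset.Icc (-(M : ℤ)) M, ek q M n • g n := by
  induction M with
  | zero => simp [g0, ek, er, ea, eD, eDn]
  | succ M ih =>
    rw [Finset.prod_range_succ, ih]
    have hz := ek_zero_of (q := q) M
    have s0 := sum_shift (ek q M) g _ _ (-((M + 1 : ℕ) : ℤ)) ((M + 1 : ℕ) : ℤ) 0 hz (by push_cast; omega) (by push_cast; omega)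
    have s1 := sum_shift (ek q M) g _ _ (-((M + 1 : ℕ) : ℤ)) ((M + 1 : ℕ) : ℤ) 1 hz (by push_cast; omega) (by push_cast; omega)
    have s2 := sum_shift (ek q M) g _ _ (-((M + 1 : ℕ) : ℤ)) ((M + 1 : ℕ) : ℤ) (-1) hz (by push_cast; omega) (by push_cast; omega)
    simp only [g1, g2, sub_zero, add_zero, sub_neg_eq_add, ← smul_mul_assoc, ← Finset.sum_mul] at s0 s1 s2
    have : ∀ n, ek q (M + 1) n • g n = (1 - eb q M / 2) • (ek q M n • g n) +
        (eb q M / 4) • (ek q M (n - 1) • g n) + (eb q M / 4) • (ek q M (n + 1) • g n) := by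
      intro n; rw [ek_rec h0 h1]; module
    simp only [this, Finset.sum_add_distrib, ← Finset.smul_sum]
    rw [s0, s1, s2]
    set S := ∑ i ∈ Finset.Icc (-(M : ℤ)) M, ek q M i • g i
    have : (1 + z) * (1 + w) = (2 : ℝ) • (1 : A) + z + w := by
      rw [mul_add, add_mul, add_mul, hzw]; simp only [one_mul, mul_one]; module
    rw [this, mul_add, mul_smul_comm, mul_smul_comm, mul_smul_comm, mul_add, mul_add, mul_smul_comm, mul_one]
    module

lemma ek_sum (h0 : 0 < q) (h1 : q < 1) (M : ℕ) : ∑ n ∈ Finset.Icc (-(M : ℤ)) M, ek q M n = 1 := by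
  have := ek_prod h0 h1 (1 : ℝ) 1 (fun _ => 1) (by simp) rfl (by simp) (by simp) M
  simp only [smul_eq_mul, mul_one] at this
  rw [← this]
  refine Finset.prod_eq_one fun m _ => by ring

lemma eD_nonneg (h0 : 0 < q) (h1 : q < 1) (k : ℤ) : 0 ≤ eD q k := by
  unfold eD; split_ifs
  · exact le_rfl
  · exact zero_le_one.trans (eDn_one_le h0 h1 _)

lemma ea_nonneg (h0 : 0 < q) (h1 : q < 1) (M : ℕ) (k : ℤ) : 0 ≤ ea q M k :=
  mul_nonneg (zpow_nonneg h0.le _) (mul_nonneg (eD_nonneg h0 h1 _) (eD_nonneg h0 h1 _))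

lemma er_mul (h0 : 0 < q) (h1 : q < 1) (M : ℕ) : er q M * ∑' n, ea q M n = 1 := by
  rw [tsum_eq_sum (s := Finset.Icc (-(M : ℤ)) M) (fun n hn => ea_zero_of M n hn), Finset.mul_sum]
  exact ek_sum h0 h1 M

lemma summ_sq (h0 : 0 < q) (h1 : q < 1) : Summable (fun n : ℤ => q ^ (n * n)) := by
  have hs : Summable (fun n : ℕ => q ^ n) := summable_geometric_of_lt_one h0.le h1
  have key : ∀ n : ℕ, q ^ ((n : ℤ) * n) ≤ q ^ n := by
    intro n
    rw [← zpow_natCast q n]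
    refine zpow_le_zpow_right_of_le_one₀ h0 h1.le ?_
    norm_cast
    exact Nat.le_mul_self n
  refine Summable.of_nat_of_neg ?_ ?_
  · exact hs.of_nonneg_of_le (fun n => by positivity) key
  · exact hs.of_nonneg_of_le (fun n => by positivity) (fun n => by simpa using key n)

lemma ek_lim (h0 : 0 < q) (h1 : q < 1) : ∃ B : ℝ, (∀ M n, 0 ≤ ek q M n ∧ ek q M n ≤ B * q ^ (n * n)) ∧
    ∀ n, Filter.Tendsto (fun M => ek q M n) Filter.atTop (nhds ((∑' k : ℤ, q ^ (k * k))⁻¹ * q ^ (n * n))) := by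
  obtain ⟨B, hB⟩ := eDn_bdd h0 h1
  have hB1 : 1 ≤ B := (eDn_one_le h0 h1 0).trans (hB 0)
  have hDB : ∀ k, eD q k ≤ B := by
    intro k; unfold eD; split_ifs
    · linarith
    · exact hB _
  have haB : ∀ M n, ea q M n ≤ B ^ 2 * q ^ (n * n) := by
    intro M n
    unfold ea
    rw [mul_comm, sq]
    have := eD_nonneg h0 h1 (M - n)
    have := eD_nonneg h0 h1 (M + n)
    have := hDB (M + n)
    have := hDB (M - n)
    gcongr
  have hsum : ∀ M, Summable (ea q M) := fun M =>
    summable_of_ne_finset_zero (s := Finset.Icc (-(M : ℤ)) M) (fun n hn => ea_zero_of M n hn)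
  have hge : ∀ M, 1 ≤ ∑' n, ea q M n := by
    intro M
    refine le_trans ?_ ((hsum M).le_tsum 0 fun n _ => ea_nonneg h0 h1 M n)
    have := eDn_one_le h0 h1 M
    simp only [ea, mul_zero, zpow_zero, one_mul, add_zero, sub_zero, eD_nat]
    nlinarith
  have her : ∀ M, er q M = (∑' n, ea q M n)⁻¹ := fun M =>
    eq_inv_of_mul_eq_one_left (er_mul h0 h1 M)
  have her0 : ∀ M, 0 ≤ er q M := fun M => by
    rw [her]; exact inv_nonneg.2 (zero_le_one.trans (hge M))
  have her1 : ∀ M, er q M ≤ 1 := fun M => by rw [her]; exact inv_le_one_of_one_le₀ (hge M)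
  refine ⟨B ^ 2, fun M n => ⟨mul_nonneg (her0 M) (ea_nonneg h0 h1 M n), ?_⟩, ?_⟩
  · have := her1 M
    have := ea_nonneg h0 h1 M n
    exact (mul_le_of_le_one_left this (her1 M)).trans (haB M n)
  set Dl := ⨆ k, eDn q k with hDl
  have hD : Filter.Tendsto (eDn q) Filter.atTop (nhds Dl) :=
    tendsto_atTop_ciSup (eDn_mono h0 h1) ⟨B, by rintro _ ⟨k, rfl⟩; exact hB k⟩
  have hDl1 : 1 ≤ Dl := ge_of_tendsto' hD (eDn_one_le h0 h1)
  have hDz : Filter.Tendsto (eD q) Filter.atTop (nhds Dl) := by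
    have : Filter.Tendsto (fun k : ℤ => eDn q k.toNat) Filter.atTop (nhds Dl) := by
      refine hD.comp ?_
      exact Filter.tendsto_atTop.2 fun n => (Filter.eventually_ge_atTop (n : ℤ)).mono fun k hk => by omega
    refine this.congr' ?_
    filter_upwards [Filter.eventually_ge_atTop (0 : ℤ)] with k hk
    simp [eD, not_lt.2 hk]
  have hM : Filter.Tendsto (fun M : ℕ => (M : ℤ)) Filter.atTop Filter.atTop := tendsto_natCast_atTop_atTop
  have ha : ∀ n, Filter.Tendsto (fun M => ea q M n) Filter.atTop (nhds (q ^ (n * n) * (Dl * Dl))) := by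
    intro n
    refine Filter.Tendsto.const_mul _ (Filter.Tendsto.mul ?_ ?_)
    · exact hDz.comp (Filter.tendsto_atTop_add_const_right _ n hM)
    · exact hDz.comp (Filter.tendsto_atTop_add_const_right _ (-n) hM)
  have hs := summ_sq h0 h1
  have hS : Filter.Tendsto (fun M => ∑' n, ea q M n) Filter.atTop
      (nhds (∑' n : ℤ, q ^ (n * n) * (Dl * Dl))) := by
    refine tendsto_tsum_of_dominated_convergence (bound := fun n : ℤ => B ^ 2 * q ^ (n * n))
      (hs.mul_left _) ha (Filter.Eventually.of_forall fun M n => ?_)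
    rw [Real.norm_of_nonneg (ea_nonneg h0 h1 M n)]
    exact haB M n
  have hth : 0 < ∑' n : ℤ, q ^ (n * n) :=
    hs.tsum_pos (fun n => by positivity) 0 (by positivity)
  intro n
  rw [tsum_mul_right] at hS
  have hne : (∑' n : ℤ, q ^ (n * n)) * (Dl * Dl) ≠ 0 := by positivity
  have := (hS.inv₀ hne).mul (ha n)
  simp only [← her] at this
  have hDl0 : Dl ≠ 0 := by positivity
  have e : (∑' k : ℤ, q ^ (k * k))⁻¹ * q ^ (n * n) =
      ((∑' k : ℤ, q ^ (k * k)) * (Dl * Dl))⁻¹ * (q ^ (n * n) * (Dl * Dl)) := by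
    generalize (∑' k : ℤ, q ^ (k * k)) = X at hth
    field_simp
  rw [e]
  exact this

end kern


section kernd

lemma eb_nonneg {q : ℝ} (h0 : 0 < q) (m : ℕ) : 0 ≤ eb q m := by unfold eb; positivity

lemma eb_le_one {q : ℝ} (h0 : 0 < q) (m : ℕ) : eb q m ≤ 1 := by
  unfold eb
  rw [div_le_one (by positivity)]
  nlinarith [sq_nonneg (1 - q ^ (2 * m + 1))]

lemma eb_mono {q r : ℝ} (h0 : 0 < q) (h : q ≤ r) (h1 : r < 1) (m : ℕ) : eb q m ≤ eb r m := by
  unfold eb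
  have a : 0 < q ^ (2 * m + 1) := by positivity
  have b : q ^ (2 * m + 1) ≤ r ^ (2 * m + 1) := pow_le_pow_left₀ h0.le h _
  have c : r ^ (2 * m + 1) ≤ 1 := pow_le_one₀ (h0.le.trans h) h1.le
  generalize q ^ (2 * m + 1) = x at *
  generalize r ^ (2 * m + 1) = y at *
  have hy : 0 < y := a.trans_le b
  rw [div_le_div_iff₀ (by positivity) (by positivity)]
  have : x * y ≤ 1 := by nlinarith
  nlinarith [mul_nonneg (sub_nonneg.2 b) (sub_nonneg.2 this)]

lemma summ_pi {d : ℕ} (h : ℤ → ℝ) (h0 : ∀ n, 0 ≤ h n) (hs : Summable h) :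
    Summable (fun n : Fin d → ℤ => ∏ j, h (n j)) := by
  classical
  refine summable_of_sum_le (c := ∏ _j : Fin d, ∑' n, h n) (fun n => Finset.prod_nonneg fun j _ => h0 _) fun s => ?_
  have : s ⊆ Fintype.piFinset (fun j : Fin d => s.image (fun n => n j)) := by
    intro n hn
    rw [Fintype.mem_piFinset]
    exact fun j => Finset.mem_image_of_mem _ hn
  refine (Finset.sum_le_sum_of_subset_of_nonneg this fun n _ _ => Finset.prod_nonneg fun j _ => h0 _).trans ?_
  rw [← Finset.prod_univ_sum]
  exact Finset.prod_le_prod (fun j _ => Finset.sum_nonneg fun n _ => h0 n)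
    fun j _ => hs.sum_le_tsum _ fun n _ => h0 n

noncomputable def eB (d : ℕ) (q : ℝ) (M : ℕ) : AddMonoidAlgebra ℝ (Fin d → ℤ) :=
  ∏ j : Fin d, ∏ m ∈ Finset.range M, ((1 - eb q m) • (1 : AddMonoidAlgebra ℝ (Fin d → ℤ)) +
    eb q m • oq (Pi.single j 1))

lemma eB_act {d : ℕ} {q : ℝ} (h0 : 0 < q) (h1 : q < 1) (M : ℕ) (f : (Fin d → ℤ) → ℝ) (y : Fin d → ℤ) :
    oAct f y (eB d q M) = ∑' n : Fin d → ℤ, (∏ j, ek q M (n j)) * f (y + n) := by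
  classical
  have e : ∀ j : Fin d, ∏ m ∈ Finset.range M, ((1 - eb q m) • (1 : AddMonoidAlgebra ℝ (Fin d → ℤ)) +
      eb q m • oq (Pi.single j 1)) = ∑ n ∈ Finset.Icc (-(M : ℤ)) M, ek q M n • oδ (Pi.single j n : Fin d → ℤ) := by
    intro j
    have h := ek_prod h0 h1 (oδ (Pi.single j 1 : Fin d → ℤ)) (oδ (-Pi.single j 1 : Fin d → ℤ))
      (fun n => oδ (Pi.single j n : Fin d → ℤ))
      (by rw [← oδ_add, add_neg_cancel, oδ_zero]) (by simp [oδ_zero])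
      (fun n => by rw [← oδ_add, Pi.single_add]) (fun n => by rw [← oδ_add, Pi.single_add, Pi.single_neg]) M
    rw [← h]
    simp only [oq, oδ_zero]
  unfold eB
  simp only [e]
  rw [Finset.prod_univ_sum, oAct_sum]
  rw [tsum_eq_sum (s := Fintype.piFinset fun _ : Fin d => Finset.Icc (-(M : ℤ)) M)]
  · refine Finset.sum_congr rfl fun n _ => ?_
    rw [Finset.prod_smul, oAct_smul, ← oδ_sum, oAct_δ, Finset.univ_sum_single]
  · intro n hn
    rw [Fintype.mem_piFinset] at hn
    push Not at hn
    obtain ⟨j, hj⟩ := hn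
    rw [Finset.prod_eq_zero (Finset.mem_univ j) (ek_zero_of M _ hj), zero_mul]

lemma exp_zpow' (x : ℝ) (n : ℤ) : Real.exp x ^ n = Real.exp (n * x) := by
  rw [← Real.rpow_intCast, ← Real.exp_mul, mul_comm]

lemma theta_eq (t : ℝ) : theta (1 / t) 0 = ∑' k : ℤ, (Real.exp (-π / t)) ^ (k * k) := by
  unfold theta
  refine tsum_congr fun k => ?_
  rw [exp_zpow']
  congr 1; push_cast; ring

lemma gauss_eq (d : ℕ) (t : ℝ) (n : Fin d → ℤ) : gauss d t n =
    ∏ j, ((∑' k : ℤ, (Real.exp (-π / t)) ^ (k * k))⁻¹ * (Real.exp (-π / t)) ^ (n j * n j)) := by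
  unfold gauss bigTheta
  rw [Finset.prod_mul_distrib, Finset.prod_inv_distrib]
  congr 1
  · simp only [Pi.zero_apply, theta_eq]
  · simp only [exp_zpow']
    rw [← Real.exp_sum, Finset.mul_sum, Finset.sum_div]
    congr 1
    refine Finset.sum_congr rfl fun j _ => ?_
    push_cast; ring

lemma gauss_neg (d : ℕ) (t : ℝ) (n : Fin d → ℤ) : gauss d t (-n) = gauss d t n := by
  simp [gauss]

lemma qt_pos (t : ℝ) : 0 < Real.exp (-π / t) := Real.exp_pos _

lemma qt_lt {t : ℝ} (ht : 0 < t) : Real.exp (-π / t) < 1 := by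
  rw [Real.exp_lt_one_iff]
  exact div_neg_of_neg_of_pos (by linarith [Real.pi_pos]) ht

lemma qt_mono {s t : ℝ} (hs : 0 < s) (h : s ≤ t) : Real.exp (-π / s) ≤ Real.exp (-π / t) := by
  rw [Real.exp_le_exp, neg_div, neg_div, neg_le_neg_iff]
  exact div_le_div_of_nonneg_left Real.pi_pos.le hs h

lemma gauss_summable (d : ℕ) {t : ℝ} (ht : 0 < t) : Summable (gauss d t) := by
  have := summ_pi (d := d) (fun n : ℤ => (∑' k : ℤ, (Real.exp (-π / t)) ^ (k * k))⁻¹ * (Real.exp (-π / t)) ^ (n * n))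
    (fun n => by positivity) ((summ_sq (qt_pos t) (qt_lt ht)).mul_left _)
  exact this.congr fun n => (gauss_eq d t n).symm

lemma gauss_nonneg (d : ℕ) {t : ℝ} (n : Fin d → ℤ) : 0 ≤ gauss d t n := by
  rw [gauss_eq]; exact Finset.prod_nonneg fun j _ => by positivity

lemma kernel_lim (d : ℕ) {t : ℝ} (ht : 0 < t) (f : (Fin d → ℤ) → ℝ) (K : ℝ) (hf : ∀ x, |f x| ≤ K)
    (y : Fin d → ℤ) :
    Filter.Tendsto (fun M => oAct f y (eB d (Real.exp (-π / t)) M)) Filter.atTop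
      (nhds (∑' n, gauss d t n * f (y - n))) := by
  have h0 := qt_pos t
  have h1 := qt_lt ht
  have e : ∑' n, gauss d t n * f (y - n) = ∑' n, gauss d t n * f (y + n) := by
    rw [← (Equiv.neg (Fin d → ℤ)).tsum_eq]
    simp [gauss_neg]
  rw [e]
  simp only [eB_act h0 h1, gauss_eq]
  generalize Real.exp (-π / t) = q at *
  obtain ⟨B, hB, hl⟩ := ek_lim h0 h1
  have hB0 : 0 ≤ B := by
    have := hB 0 0
    simp at this
    linarith
  refine tendsto_tsum_of_dominated_convergence (bound := fun n : Fin d → ℤ => (∏ j, (B * q ^ (n j * n j))) * K)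
    ?_ ?_ (Filter.Eventually.of_forall fun M n => ?_)
  · exact (summ_pi (fun n : ℤ => B * q ^ (n * n)) (fun n => by positivity)
      ((summ_sq h0 h1).mul_left _)).mul_right K
  · intro n
    exact (tendsto_finsetProd _ fun j _ => hl (n j)).mul_const _
  · rw [norm_mul, Real.norm_of_nonneg (Finset.prod_nonneg fun j _ => (hB M (n j)).1)]
    refine mul_le_mul ?_ (hf _) (norm_nonneg _) (Finset.prod_nonneg fun j _ => by positivity)
    exact Finset.prod_le_prod (fun j _ => (hB M (n j)).1) fun j _ => (hB M (n j)).2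

end kernd


section assemble

noncomputable def gidx (S : Finset ℝ) (t : ℝ) : ℕ := (S.filter fun s => t < s).card

lemma gidx_anti (S : Finset ℝ) : Antitone (gidx S) := by
  intro a b h
  refine Finset.card_le_card fun s => ?_
  simp only [Finset.mem_filter]
  exact fun hs => ⟨hs.1, h.trans_lt hs.2⟩

lemma gidx_le (S : Finset ℝ) {t t' : ℝ} (ht' : t' ∈ S) (h : gidx S t ≤ gidx S t') : t' ≤ t := by
  by_contra h2
  push Not at h2
  refine absurd h (not_le.2 (Finset.card_lt_card ?_))
  rw [Finset.ssubset_iff_of_subset]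
  · exact ⟨t', by simp [ht', h2], by simp⟩
  · intro s
    simp only [Finset.mem_filter]
    exact fun hs => ⟨hs.1, h2.trans hs.2⟩

lemma gidx_fun (S : Finset ℝ) (φ : ℝ → ℝ) (h : ∀ s ∈ S, ∀ t ∈ S, s ≤ t → φ s ≤ φ t)
    (h0 : ∀ s ∈ S, 0 ≤ φ s) (h1 : ∀ s ∈ S, φ s ≤ 1) :
    ∃ c : ℕ → ℝ, Antitone c ∧ (∀ n, 0 ≤ c n) ∧ (∀ n, c n ≤ 1) ∧ ∀ t ∈ S, c (gidx S t) = φ t := by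
  refine ⟨fun n => (((S.filter fun s => n ≤ gidx S s).sup fun s => (φ s).toNNReal : NNReal) : ℝ),
    ?_, fun n => NNReal.coe_nonneg _, ?_, ?_⟩
  · intro a b hab
    refine NNReal.coe_le_coe.2 (Finset.sup_mono fun s => ?_)
    simp only [Finset.mem_filter]
    exact fun hs => ⟨hs.1, hab.trans hs.2⟩
  · intro n
    rw [← NNReal.coe_one, NNReal.coe_le_coe]
    refine Finset.sup_le fun s hs => ?_
    rw [Real.toNNReal_le_one]
    exact h1 s (Finset.mem_filter.1 hs).1
  · intro t ht
    rw [← Real.coe_toNNReal (φ t) (h0 t ht)]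
    refine congrArg NNReal.toReal (le_antisymm (Finset.sup_le fun s hs => ?_) ?_)
    · rw [Finset.mem_filter] at hs
      exact Real.toNNReal_le_toNNReal (h s hs.1 t ht (gidx_le S hs.1 hs.2))
    · exact Finset.le_sup (f := fun s => (φ s).toNNReal) (Finset.mem_filter.2 ⟨ht, le_rfl⟩)

noncomputable def gReal (d : ℕ) (t : ℝ) (f : (Fin d → ℤ) → ℝ) (y : Fin d → ℤ) : ℝ :=
  ∑' n, gauss d t n * f (y - n)

lemma fin_prod_aux {A : Type*} [CommMonoid A] (d M : ℕ) (g : Fin d → ℕ → A) :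
    ∏ i : Fin (d * M), g (finProdFinEquiv.symm i).1 (finProdFinEquiv.symm i).2 =
      ∏ j, ∏ m ∈ Finset.range M, g j m := by
  rw [Equiv.prod_comp (finProdFinEquiv.symm) (fun z : Fin d × Fin M => g z.1 z.2),
    Fintype.prod_prod_type]
  refine Finset.prod_congr rfl fun j _ => ?_
  exact Fin.prod_univ_eq_prod_range (fun m => g j m) M

set_option maxHeartbeats 1000000 in
theorem real_ineq (p : ℝ) (hp : 1 < p) : ∃ C : ℝ, 0 ≤ C ∧ ∀ (d : ℕ) (f : (Fin d → ℤ) → ℝ),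
    (∀ x, 0 ≤ f x) → Summable (fun x => f x ^ p) → ∀ (J : ℕ) (u : ℕ → ℝ), Monotone u → (∀ j, 0 < u j) →
    ∀ (T : (Fin d → ℤ) → ℕ → ℝ) (Y : Finset (Fin d → ℤ)),
    (∀ y ∈ Y, ∀ j < J, u j ≤ T y j) → (∀ y ∈ Y, ∀ j < J, T y j ≤ u (j + 1)) →
    ∑ y ∈ Y, (∑ j ∈ Finset.range J, (gReal d (T y j) f y - gReal d (u j) f y) ^ 2) ^ (p / 2)
      ≤ C * ∑' x, f x ^ p := by
  classical
  obtain ⟨C, hC, H⟩ := thmD p hp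
  refine ⟨C, hC, ?_⟩
  intro d f hf hs J u hu hu0 T Y hT1 hT2
  set S : Finset ℝ := (Finset.range (J + 1)).image u ∪
    (Y ×ˢ Finset.range J).image (fun z => T z.1 z.2) with hS
  have hSu : ∀ j ≤ J, u j ∈ S := fun j hj => Finset.mem_union_left _
    (Finset.mem_image_of_mem _ (Finset.mem_range.2 (by omega)))
  have hST : ∀ y ∈ Y, ∀ j < J, T y j ∈ S := fun y hy j hj => Finset.mem_union_right _
    (Finset.mem_image.2 ⟨(y, j), Finset.mem_product.2 ⟨hy, Finset.mem_range.2 hj⟩, rfl⟩)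
  have hS0 : ∀ s ∈ S, 0 < s := by
    intro s hs
    rcases Finset.mem_union.1 hs with h | h
    · obtain ⟨j, _, rfl⟩ := Finset.mem_image.1 h; exact hu0 j
    · obtain ⟨⟨y, j⟩, hz, rfl⟩ := Finset.mem_image.1 h
      rw [Finset.mem_product, Finset.mem_range] at hz
      exact (hu0 j).trans_le (hT1 y hz.1 j hz.2)
  have hc : ∀ m : ℕ, ∃ c : ℕ → ℝ, Antitone c ∧ (∀ n, 0 ≤ c n) ∧ (∀ n, c n ≤ 1) ∧
      ∀ t ∈ S, c (gidx S t) = eb (Real.exp (-π / t)) m := fun m =>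
    gidx_fun S (fun t => eb (Real.exp (-π / t)) m)
      (fun s hs t ht hst => eb_mono (qt_pos s) (qt_mono (hS0 s hs) hst) (qt_lt (hS0 t ht)) m)
      (fun s _ => eb_nonneg (qt_pos s) m) (fun s _ => eb_le_one (qt_pos s) m)
  choose c hca hc0 hc1 hce using hc
  set β : ℕ → ℕ := fun j => gidx S (u (min j J)) with hβ
  have hβa : Antitone β := fun a b hab => gidx_anti S (hu (by omega))
  set κ : (Fin d → ℤ) → ℕ → ℕ := fun y j => if y ∈ Y then gidx S (T y j) else β j with hκ
  have hκ1 : ∀ y, ∀ j < J, β (j + 1) ≤ κ y j := by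
    intro y j hj
    simp only [hκ]
    split_ifs with h
    · refine gidx_anti S ?_
      rw [min_eq_left (by omega)]; exact hT2 y h j hj
    · exact hβa (by omega)
  have hκ2 : ∀ y, ∀ j < J, κ y j ≤ β j := by
    intro y j hj
    simp only [hκ]
    split_ifs with h
    · refine gidx_anti S ?_
      rw [min_eq_left (by omega)]; exact hT1 y h j hj
    · exact le_rfl
  have hB : ∀ M, ∀ t ∈ S, ∀ n, n = gidx S t → (∏ i : Fin (d * M), ((1 - c (finProdFinEquiv.symm i).2 n) •
      (1 : AddMonoidAlgebra ℝ (Fin d → ℤ)) + c (finProdFinEquiv.symm i).2 n •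
        oq (Pi.single (finProdFinEquiv.symm i).1 1 : Fin d → ℤ))) = eB d (Real.exp (-π / t)) M := by
    rintro M t ht n rfl
    have h := fin_prod_aux d M (fun (j : Fin d) (m : ℕ) => ((1 - c m (gidx S t)) •
      (1 : AddMonoidAlgebra ℝ (Fin d → ℤ)) + c m (gidx S t) • oq (Pi.single j 1 : Fin d → ℤ)))
    refine h.trans ?_
    simp only [hce _ t ht]
    rfl
  have hM : ∀ M, ∑ y ∈ Y, (∑ j ∈ Finset.range J, (oAct f y (eB d (Real.exp (-π / T y j)) M)
      - oAct f y (eB d (Real.exp (-π / u j)) M)) ^ 2) ^ (p / 2) ≤ C * ∑' x, f x ^ p := by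
    intro M
    refine le_trans (le_of_eq ?_) (H (Fin d → ℤ) (d * M)
      (fun i => (Pi.single (finProdFinEquiv.symm i).1 1 : Fin d → ℤ))
      (fun i => c (finProdFinEquiv.symm i).2) (fun i => hca _) (fun i => hc0 _) (fun i => hc1 _)
      f hf hs β hβa J κ hκ1 hκ2 Y)
    refine Finset.sum_congr rfl fun y hy => ?_
    congr 1
    refine Finset.sum_congr rfl fun j hj => ?_
    rw [Finset.mem_range] at hj
    rw [hB M (T y j) (hST y hy j hj) (κ y j) (by simp [hκ, hy]),
      hB M (u j) (hSu j hj.le) (β j) (by simp only [hβ]; rw [min_eq_left hj.le])]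
  have hbd : ∃ K, ∀ x, |f x| ≤ K := by
    refine ⟨(∑' x, f x ^ p) ^ (1 / p), fun x => ?_⟩
    rw [abs_of_nonneg (hf x)]
    have := hs.le_tsum x (fun y _ => Real.rpow_nonneg (hf y) p)
    calc f x = (f x ^ p) ^ (1 / p) := by
          rw [← Real.rpow_mul (hf x), mul_one_div_cancel (by linarith), Real.rpow_one]
      _ ≤ _ := Real.rpow_le_rpow (Real.rpow_nonneg (hf x) p) this (by positivity)
  obtain ⟨K, hK⟩ := hbd
  refine le_of_tendsto' (f := fun M => ∑ y ∈ Y, (∑ j ∈ Finset.range J, (oAct f y (eB d (Real.exp (-π / T y j)) M)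
      - oAct f y (eB d (Real.exp (-π / u j)) M)) ^ 2) ^ (p / 2)) (x := Filter.atTop) ?_ hM
  refine tendsto_finsetSum _ fun y hy => ?_
  refine Filter.Tendsto.rpow_const ?_ (Or.inr (by linarith))
  refine tendsto_finsetSum _ fun j hj => ?_
  rw [Finset.mem_range] at hj
  exact ((kernel_lim d (hS0 _ (hST y hy j hj)) f K hK y).sub
    (kernel_lim d (hu0 j) f K hK y)).pow 2

end assemble



lemma four_rpow {s : ℝ} (hs : 0 ≤ s) (a : Fin 4 → ℝ) (ha : ∀ i, 0 ≤ a i) :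
    (2 * ∑ i, a i) ^ s ≤ 8 ^ s * ∑ i, a i ^ s := by
  obtain ⟨i, _, hi⟩ := Finset.exists_max_image Finset.univ a ⟨0, Finset.mem_univ _⟩
  have h1 : ∑ j, a j ≤ 4 * a i := by
    have := Finset.sum_le_card_nsmul Finset.univ a (a i) hi
    simpa using this
  calc (2 * ∑ i, a i) ^ s ≤ (8 * a i) ^ s :=
        Real.rpow_le_rpow (mul_nonneg (by norm_num) (Finset.sum_nonneg fun j _ => ha j)) (by linarith) hs
    _ = 8 ^ s * a i ^ s := Real.mul_rpow (by norm_num) (ha i)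
    _ ≤ _ := mul_le_mul_of_nonneg_left
        (Finset.single_le_sum (f := fun j => a j ^ s) (fun j _ => Real.rpow_nonneg (ha j) s) (Finset.mem_univ i))
        (by positivity)

noncomputable def part (r : Fin 4) (z : ℂ) : ℝ :=
  match r with
  | 0 => max z.re 0
  | 1 => max (-z.re) 0
  | 2 => max z.im 0
  | 3 => max (-z.im) 0

lemma part_nonneg (r : Fin 4) (z : ℂ) : 0 ≤ part r z := by
  fin_cases r <;> simp [part]

lemma part_le (r : Fin 4) (z : ℂ) : part r z ≤ ‖z‖ := by
  have h1 := abs_le.1 (Complex.abs_re_le_norm z)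
  have h2 := abs_le.1 (Complex.abs_im_le_norm z)
  have h3 := norm_nonneg z
  fin_cases r <;> simp only [part] <;> refine max_le ?_ h3 <;> linarith [h1.1, h1.2, h2.1, h2.2]

lemma part_re (z : ℂ) : z.re = part 0 z - part 1 z := by
  simp only [part]
  rcases le_total z.re 0 with h | h
  · rw [max_eq_right h, max_eq_left (by linarith)]; ring
  · rw [max_eq_left h, max_eq_right (by linarith)]; ring

lemma part_im (z : ℂ) : z.im = part 2 z - part 3 z := by
  simp only [part]
  rcases le_total z.im 0 with h | h
  · rw [max_eq_right h, max_eq_left (by linarith)]; ring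
  · rw [max_eq_left h, max_eq_right (by linarith)]; ring

lemma gReal_summable (d : ℕ) {t : ℝ} (ht : 0 < t) (f : (Fin d → ℤ) → ℝ) (K : ℝ) (hf : ∀ x, |f x| ≤ K)
    (y : Fin d → ℤ) : Summable (fun n => gauss d t n * f (y - n)) := by
  refine Summable.of_norm_bounded ((gauss_summable d ht).mul_right K) fun n => ?_
  rw [norm_mul, Real.norm_of_nonneg (gauss_nonneg d n)]
  exact mul_le_mul_of_nonneg_left (hf _) (gauss_nonneg d n)

lemma gConv_parts (d : ℕ) {t : ℝ} (ht : 0 < t) (f : (Fin d → ℤ) → ℂ) (K : ℝ) (hf : ∀ x, ‖f x‖ ≤ K)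
    (y : Fin d → ℤ) :
    (gConv d t f y).re = gReal d t (fun x => part 0 (f x)) y - gReal d t (fun x => part 1 (f x)) y ∧
    (gConv d t f y).im = gReal d t (fun x => part 2 (f x)) y - gReal d t (fun x => part 3 (f x)) y := by
  have hs : Summable (fun n => (gauss d t n : ℂ) * f (y - n)) := by
    refine Summable.of_norm_bounded ((gauss_summable d ht).mul_right K) fun n => ?_
    rw [norm_mul, Complex.norm_real, Real.norm_of_nonneg (gauss_nonneg d n)]
    exact mul_le_mul_of_nonneg_left (hf _) (gauss_nonneg d n)
  have hp : ∀ r : Fin 4, Summable (fun n => gauss d t n * part r (f (y - n))) := fun r =>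
    gReal_summable d ht (fun x => part r (f x)) K (fun x => by
      rw [abs_of_nonneg (part_nonneg r _)]; exact (part_le r _).trans (hf x)) y
  unfold gConv gReal
  rw [Complex.re_tsum hs, Complex.im_tsum hs, ← (hp 0).tsum_sub (hp 1), ← (hp 2).tsum_sub (hp 3)]
  constructor
  · refine tsum_congr fun n => ?_
    rw [Complex.re_ofReal_mul, part_re, mul_sub]
  · refine tsum_congr fun n => ?_
    rw [Complex.im_ofReal_mul, part_im, mul_sub]

theorem complex_ineq (p : ℝ) (hp : 1 < p) : ∃ C : ℝ, 0 ≤ C ∧ ∀ (d : ℕ) (f : (Fin d → ℤ) → ℂ),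
    Summable (fun x => ‖f x‖ ^ p) → ∀ (J : ℕ) (u : ℕ → ℝ), Monotone u → (∀ j, 0 < u j) →
    ∀ (T : (Fin d → ℤ) → ℕ → ℝ) (Y : Finset (Fin d → ℤ)),
    (∀ y ∈ Y, ∀ j < J, u j ≤ T y j) → (∀ y ∈ Y, ∀ j < J, T y j ≤ u (j + 1)) →
    ∑ y ∈ Y, (∑ j ∈ Finset.range J, ‖gConv d (T y j) f y - gConv d (u j) f y‖ ^ 2) ^ (p / 2)
      ≤ C * ∑' x, ‖f x‖ ^ p := by
  obtain ⟨C, hC, H⟩ := real_ineq p hp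
  refine ⟨8 ^ (p / 2) * (4 * C), by positivity, ?_⟩
  intro d f hs J u hu hu0 T Y hT1 hT2
  have hbd : ∃ K, ∀ x, ‖f x‖ ≤ K := by
    refine ⟨(∑' x, ‖f x‖ ^ p) ^ (1 / p), fun x => ?_⟩
    have := hs.le_tsum x (fun y _ => Real.rpow_nonneg (norm_nonneg (f y)) p)
    calc ‖f x‖ = (‖f x‖ ^ p) ^ (1 / p) := by
          rw [← Real.rpow_mul (norm_nonneg _), mul_one_div_cancel (by linarith), Real.rpow_one]
      _ ≤ _ := Real.rpow_le_rpow (by positivity) this (by positivity)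
  obtain ⟨K, hK⟩ := hbd
  have hps : ∀ r : Fin 4, Summable (fun x => part r (f x) ^ p) := fun r =>
    Summable.of_nonneg_of_le (fun x => Real.rpow_nonneg (part_nonneg r _) p)
      (fun x => Real.rpow_le_rpow (part_nonneg r _) (part_le r _) (by linarith)) hs
  have hr : ∀ r : Fin 4, ∑ y ∈ Y, (∑ j ∈ Finset.range J, (gReal d (T y j) (fun x => part r (f x)) y
      - gReal d (u j) (fun x => part r (f x)) y) ^ 2) ^ (p / 2) ≤ C * ∑' x, ‖f x‖ ^ p := by
    intro r
    refine (H d (fun x => part r (f x)) (fun x => part_nonneg r _) (hps r) J u hu hu0 T Y hT1 hT2).trans ?_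
    refine mul_le_mul_of_nonneg_left ((hps r).tsum_le_tsum (fun x =>
      Real.rpow_le_rpow (part_nonneg r _) (part_le r _) (by linarith)) hs) hC
  have hpt : ∀ y ∈ Y, (∑ j ∈ Finset.range J, ‖gConv d (T y j) f y - gConv d (u j) f y‖ ^ 2) ^ (p / 2) ≤
      8 ^ (p / 2) * ∑ r : Fin 4, (∑ j ∈ Finset.range J, (gReal d (T y j) (fun x => part r (f x)) y
      - gReal d (u j) (fun x => part r (f x)) y) ^ 2) ^ (p / 2) := by
    intro y hy
    refine le_trans (Real.rpow_le_rpow (Finset.sum_nonneg fun j _ => sq_nonneg _) ?_ (by linarith))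
      (four_rpow (by linarith) _ fun r => Finset.sum_nonneg fun j _ => sq_nonneg _)
    rw [Finset.sum_comm, Finset.mul_sum]
    refine Finset.sum_le_sum fun j hj => ?_
    rw [Finset.mem_range] at hj
    have h1 := gConv_parts d ((hu0 j).trans_le (hT1 y hy j hj)) f K hK y
    have h2 := gConv_parts d (hu0 j) f K hK y
    rw [← Complex.normSq_eq_norm_sq, Complex.normSq_apply, Complex.sub_re, Complex.sub_im, h1.1, h1.2, h2.1, h2.2,
      Fin.sum_univ_four]
    generalize gReal d (T y j) (fun x => part 0 (f x)) y = a0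
    generalize gReal d (T y j) (fun x => part 1 (f x)) y = a1
    generalize gReal d (T y j) (fun x => part 2 (f x)) y = a2
    generalize gReal d (T y j) (fun x => part 3 (f x)) y = a3
    generalize gReal d (u j) (fun x => part 0 (f x)) y = b0
    generalize gReal d (u j) (fun x => part 1 (f x)) y = b1
    generalize gReal d (u j) (fun x => part 2 (f x)) y = b2
    generalize gReal d (u j) (fun x => part 3 (f x)) y = b3
    nlinarith [sq_nonneg ((a0 - b0) + (a1 - b1)), sq_nonneg ((a2 - b2) + (a3 - b3))]
  refine (Finset.sum_le_sum hpt).trans ?_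
  rw [← Finset.mul_sum, Finset.sum_comm, mul_assoc]
  refine mul_le_mul_of_nonneg_left ?_ (by positivity)
  refine (Finset.sum_le_sum fun r _ => hr r).trans (le_of_eq ?_)
  simp; ring

lemma exists_seq_biSup (s : Set ℝ) (hs : s.Nonempty) (a : ℝ → ℝ≥0∞) :
    ∃ τ : ℕ → ℝ, (∀ k, τ k ∈ s) ∧ Filter.Tendsto (fun k => a (τ k)) Filter.atTop (nhds (⨆ t ∈ s, a t)) := by
  obtain ⟨v, _, hv, hm⟩ := exists_seq_tendsto_sSup (S := a '' s) (hs.image a) (OrderTop.bddAbove _)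
  choose τ hτ he using hm
  refine ⟨τ, hτ, ?_⟩
  simp only [he]
  rwa [sSup_image] at hv

/-- Dimension-free ℓ^p 2-oscillation inequality for the discrete Gaussian family `G_t`: for each
`p ∈ (1,∞)` there is `C_p > 0`, independent of the dimension `d`, such that for every `J ∈ ℤ_+`,
every strictly increasing sequence `I_0 < I_1 < … < I_J` in `(0,∞)` and every `f ∈ ℓ^p(ℤ^d)` one
has `‖O_{I,J}^2(G_t f : t>0)‖_{ℓ^p} ≤ C_p ‖f‖_{ℓ^p}`, where
`O_{I,J}^2(a_t : t>0) = (Σ_{j<J} sup_{t ∈ [I_j, I_{j+1})} |a_t - a_{I_j}|²)^{1/2}`. -/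
theorem oscillation_gauss_dimension_free (p : ℝ) (hp : 1 < p) :
    ∃ C : ℝ, 0 < C ∧ ∀ d : ℕ, 0 < d →
      ∀ J : ℕ, 0 < J → ∀ u : Fin (J + 1) → ℝ, StrictMono u → (∀ j, 0 < u j) →
      ∀ f : (Fin d → ℤ) → ℂ,
      lpNorm d p (fun x => (‖f x‖₊ : ℝ≥0∞)) < ⊤ →
      lpNorm d p (fun x =>
          (∑ j : Fin J, ⨆ (t : ℝ) (_ : t ∈ Set.Ico (u j.castSucc) (u j.succ)),
              (‖gConv d t f x - gConv d (u j.castSucc) f x‖₊ : ℝ≥0∞) ^ (2 : ℕ)) ^ (1/2 : ℝ))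
        ≤ ENNReal.ofReal C * lpNorm d p (fun x => (‖f x‖₊ : ℝ≥0∞)) := by
  obtain ⟨C, hC, H⟩ := complex_ineq p hp
  have hp0 : 0 < p := by linarith
  refine ⟨(C + 1) ^ (1 / p), by positivity, ?_⟩
  intro d _ J _ u hu hu0 f hf
  have hne : ∑' x, (‖f x‖₊ : ℝ≥0∞) ^ p ≠ ⊤ := by
    intro h
    simp only [lpNorm, h] at hf
    rw [ENNReal.top_rpow_of_pos (by positivity)] at hf
    exact lt_irrefl _ hf
  have hco : ∀ x, (‖f x‖₊ : ℝ≥0∞) ^ p = ENNReal.ofReal (‖f x‖ ^ p) := by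
    intro x
    rw [← ENNReal.ofReal_rpow_of_nonneg (norm_nonneg _) hp0.le, ofReal_norm]; rfl
  simp only [hco] at hne
  have hs : Summable (fun x => ‖f x‖ ^ p) := by
    have := ENNReal.summable_toReal hne
    exact this.congr fun x => (ENNReal.toReal_ofReal (by positivity))
  have hts : ∑' x, (‖f x‖₊ : ℝ≥0∞) ^ p = ENNReal.ofReal (∑' x, ‖f x‖ ^ p) := by
    rw [ENNReal.ofReal_tsum_of_nonneg (fun x => by positivity) hs]
    exact tsum_congr hco
  unfold lpNorm
  rw [← ENNReal.ofReal_rpow_of_nonneg (by positivity) (by positivity), ← ENNReal.mul_rpow_of_nonneg _ _ (by positivity)]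
  refine ENNReal.rpow_le_rpow ?_ (by positivity)
  rw [hts, ← ENNReal.ofReal_mul (by positivity)]
  simp only [← ENNReal.rpow_mul]
  rw [show (1 / 2 * p : ℝ) = p / 2 by ring]
  rw [ENNReal.tsum_eq_iSup_sum]
  refine iSup_le fun Y => ?_
  set u' : ℕ → ℝ := fun j => u ⟨min j J, by omega⟩ with hu'
  have hu'm : Monotone u' := fun a b hab => hu.monotone (Fin.mk_le_mk.2 (by omega))
  have hu'1 : ∀ j : Fin J, u j.castSucc = u' j := fun j => congrArg u (Fin.ext (by simp <;> omega))
  have hu'2 : ∀ j : Fin J, u j.succ = u' (j + 1) := fun j => congrArg u (Fin.ext (by simp <;> omega))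
  have hseq : ∀ (y : Fin d → ℤ) (j : Fin J), ∃ τ : ℕ → ℝ, (∀ k, τ k ∈ Set.Ico (u j.castSucc) (u j.succ)) ∧
      Filter.Tendsto (fun k => (‖gConv d (τ k) f y - gConv d (u j.castSucc) f y‖₊ : ℝ≥0∞) ^ (2 : ℕ)) Filter.atTop
        (nhds (⨆ (t : ℝ) (_ : t ∈ Set.Ico (u j.castSucc) (u j.succ)),
              (‖gConv d t f y - gConv d (u j.castSucc) f y‖₊ : ℝ≥0∞) ^ (2 : ℕ))) := fun y j =>
    exists_seq_biSup _ ⟨u j.castSucc, Set.left_mem_Ico.2 (hu (Fin.castSucc_lt_succ))⟩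
      (fun t => (‖gConv d t f y - gConv d (u j.castSucc) f y‖₊ : ℝ≥0∞) ^ (2 : ℕ))
  choose τ hτ hτl using hseq
  refine le_of_tendsto' (f := fun k => ∑ y ∈ Y, (∑ j : Fin J,
      (‖gConv d (τ y j k) f y - gConv d (u j.castSucc) f y‖₊ : ℝ≥0∞) ^ (2 : ℕ)) ^ (p / 2)) (x := Filter.atTop) ?_ ?_
  · refine tendsto_finsetSum _ fun y _ => ?_
    exact (ENNReal.continuous_rpow_const.tendsto _).comp (tendsto_finsetSum _ fun j _ => hτl y j)
  intro k
  set T : (Fin d → ℤ) → ℕ → ℝ := fun y j => if h : j < J then τ y ⟨j, h⟩ k else 0 with hT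
  have hTj : ∀ y (j : Fin J), T y j = τ y j k := fun y j => by simp [hT]
  have hmain := H d f hs J u' hu'm (fun j => hu0 _) T Y
    (fun y _ j hj => by
      have h1 := (hτ y ⟨j, hj⟩ k).1
      rw [hu'1] at h1
      simpa [hT, hj] using h1)
    (fun y _ j hj => by
      have h1 := (hτ y ⟨j, hj⟩ k).2
      rw [hu'2] at h1
      simpa [hT, hj] using h1.le)
  have e : ∑ y ∈ Y, (∑ j : Fin J,
      (‖gConv d (τ y j k) f y - gConv d (u j.castSucc) f y‖₊ : ℝ≥0∞) ^ (2 : ℕ)) ^ (p / 2) =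
      ENNReal.ofReal (∑ y ∈ Y, (∑ j ∈ Finset.range J,
        ‖gConv d (T y j) f y - gConv d (u' j) f y‖ ^ 2) ^ (p / 2)) := by
    rw [ENNReal.ofReal_sum_of_nonneg (fun y _ => by positivity)]
    refine Finset.sum_congr rfl fun y _ => ?_
    rw [← ENNReal.ofReal_rpow_of_nonneg (by positivity) (by positivity),
      ENNReal.ofReal_sum_of_nonneg (fun j _ => by positivity),
      ← Fin.sum_univ_eq_sum_range (fun j => ENNReal.ofReal (‖gConv d (T y j) f y - gConv d (u' j) f y‖ ^ 2))]
    congr 1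
    refine Finset.sum_congr rfl fun j _ => ?_
    rw [hTj, ← hu'1, ENNReal.ofReal_pow (norm_nonneg _), ofReal_norm]; rfl
  rw [e]
  refine ENNReal.ofReal_le_ofReal (hmain.trans ?_)
  have : 0 ≤ ∑' x, ‖f x‖ ^ p := tsum_nonneg fun x => by positivity
  nlinarith
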